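/- Let F be a field of characteristic 2, let φ be an anisotropic quadratic form over F of dimension 5 and type (1,3) that is not a Pfister neighbour, and let ψ be an anisotropic quadratic form over F of type (r,s) with r ≥ 3. Then the scalar extension φ_{F(ψ)} of φ to the function field F(ψ) is anisotropic. -/

import Mathlib

open QuadraticMap MvPolynomial
open scoped TensorProduct

set_option synthInstance.maxHeartbeats 1000000
set_option maxHeartbeats 1000000


section Defs

variable {K : Type} [CommRing K]

/-- The binary quadratic form `[a,b] : (x,y) ↦ a·x² + x·y + b·y²`. -/
noncomputable def binQF (a b : K) : QuadraticForm K (Fin 2 → K) :=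
  (Matrix.of ![![a, 1], ![0, b]]).toQuadraticMap'

/-- The diagonal (totally singular) quadratic form `⟨c₁, …, c_s⟩`. -/
noncomputable def diagQF {s : ℕ} (c : Fin s → K) : QuadraticForm K (Fin s → K) :=
  QuadraticMap.weightedSumSquares K c

/-- The orthogonal sum `[a₁,b₁] ⊥ ⋯ ⊥ [a_r,b_r]` of binary forms. -/
noncomputable def binsQF {r : ℕ} (a b : Fin r → K) : QuadraticForm K (Fin r → Fin 2 → K) :=
  QuadraticMap.pi fun i => binQF (a i) (b i)

/-- The orthogonal sum of `m` hyperbolic planes `[0,0]`. -/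
noncomputable def hypQF (K : Type) [CommRing K] (m : ℕ) :
    QuadraticForm K (Fin m → Fin 2 → K) :=
  binsQF (fun _ => 0) (fun _ => 0)

/-- The `(n+1)`-fold quadratic Pfister form `⟨⟨a₁,…,aₙ⟩⟩_b ⊗ [1,c]`, i.e. the orthogonal
sum over all subsets `S ⊆ {1,…,n}` of `(∏_{i∈S} aᵢ)·[1,c]`. -/
noncomputable def pfisterQF (n : ℕ) (a : Fin n → K) (c : K) :
    QuadraticForm K (Finset (Fin n) → Fin 2 → K) :=
  QuadraticMap.pi fun S : Finset (Fin n) => (∏ i ∈ S, a i) • binQF 1 c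

variable {V W : Type} [AddCommGroup V] [Module K V] [AddCommGroup W] [Module K W]

/-- `φ` has type `(r,s)`: it is isometric to `[a₁,b₁] ⊥ ⋯ ⊥ [a_r,b_r] ⊥ ⟨c₁,…,c_s⟩`. -/
def HasTypeRS (φ : QuadraticForm K V) (r s : ℕ) : Prop :=
  ∃ (a b : Fin r → K) (c : Fin s → K), φ.Equivalent ((binsQF a b).prod (diagQF c))

/-- `φ` is dominated by `ψ`. -/
def Dominated (φ : QuadraticForm K V) (ψ : QuadraticForm K W) : Prop :=
  ∃ f : V →ₗ[K] W, Function.Injective f ∧ ∀ v, φ v = ψ (f v)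

/-- `φ` is weakly dominated by `ψ`: `α·φ` is dominated by `ψ` for some unit `α`. -/
def WeaklyDominated (φ : QuadraticForm K V) (ψ : QuadraticForm K W) : Prop :=
  ∃ α : Kˣ, Dominated ((α : K) • φ) ψ

/-- Witt equivalence of quadratic forms. -/
def WittEquiv (Q₁ : QuadraticForm K V) (Q₂ : QuadraticForm K W) : Prop :=
  ∃ k l : ℕ, (Q₁.prod (hypQF K k)).Equivalent (Q₂.prod (hypQF K l))

/-- `φ` is a Pfister neighbour: there is a quadratic Pfister form `π` with
`2·dim φ > dim π` and `φ ≺_w π`. -/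
def IsPfisterNeighbour (φ : QuadraticForm K V) : Prop :=
  ∃ (n : ℕ) (a : Fin n → Kˣ) (c : K),
    2 * Module.finrank K V > 2 ^ (n + 1) ∧
      WeaklyDominated φ (pfisterQF n (fun i => (a i : K)) c)

/-- The Artin–Schreier set `℘(K) = {t² + t : t ∈ K}`. -/
def ArtinSchreier (K : Type) [CommRing K] : Set K := {x : K | ∃ t : K, x = t ^ 2 + t}

end Defs

section FunField

variable (F : Type) [Field F]

/-- The coefficient matrix of a quadratic form on `Fin n → F` with respect to the
standard basis: diagonal entries `ψ(eᵢ)`, above-diagonal entries `b_ψ(eᵢ,eⱼ)`. -/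
noncomputable def coeffMat {n : ℕ} (ψ : QuadraticForm F (Fin n → F)) :
    Matrix (Fin n) (Fin n) F :=
  Matrix.of fun i j =>
    if i = j then ψ (Pi.single i 1)
    else if i < j then polar ψ (Pi.single i 1) (Pi.single j 1) else 0

/-- The homogeneous degree 2 polynomial `P_ψ` associated to a quadratic form `ψ`. -/
noncomputable def qfPoly {n : ℕ} (ψ : QuadraticForm F (Fin n → F)) :
    MvPolynomial (Fin n) F :=
  ∑ i : Fin n, ∑ j : Fin n, MvPolynomial.C (coeffMat F ψ i j) * (X i * X j)

/-- The affine coordinate ring `F[x₁,…,xₙ]/(P_ψ)` of the quadric `ψ = 0`. -/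
def FunFieldRing {n : ℕ} (ψ : QuadraticForm F (Fin n → F)) : Type :=
  MvPolynomial (Fin n) F ⧸ Ideal.span {qfPoly F ψ}

noncomputable instance {n : ℕ} (ψ : QuadraticForm F (Fin n → F)) :
    CommRing (FunFieldRing F ψ) :=
  inferInstanceAs (CommRing (MvPolynomial (Fin n) F ⧸ Ideal.span {qfPoly F ψ}))

noncomputable instance {n : ℕ} (ψ : QuadraticForm F (Fin n → F)) :
    Algebra F (FunFieldRing F ψ) :=
  inferInstanceAs (Algebra F (MvPolynomial (Fin n) F ⧸ Ideal.span {qfPoly F ψ}))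

/-- The function field `F(ψ)` of the quadric `ψ = 0`. -/
def FunField {n : ℕ} (ψ : QuadraticForm F (Fin n → F)) : Type :=
  FractionRing (FunFieldRing F ψ)

noncomputable instance {n : ℕ} (ψ : QuadraticForm F (Fin n → F)) :
    CommRing (FunField F ψ) :=
  inferInstanceAs (CommRing (FractionRing (FunFieldRing F ψ)))

noncomputable instance {n : ℕ} (ψ : QuadraticForm F (Fin n → F)) :
    Algebra (FunFieldRing F ψ) (FunField F ψ) :=
  inferInstanceAs (Algebra (FunFieldRing F ψ) (FractionRing (FunFieldRing F ψ)))

noncomputable instance {n : ℕ} (ψ : QuadraticForm F (Fin n → F)) :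
    Algebra F (FunField F ψ) :=
  inferInstanceAs (Algebra F (FractionRing (FunFieldRing F ψ)))

/-- The canonical map `F → F(ψ)`. -/
noncomputable def funFieldMap {n : ℕ} (ψ : QuadraticForm F (Fin n → F)) :
    F →+* FunField F ψ :=
  algebraMap F (FunField F ψ)

/-- Scalar extension of a quadratic form on `Fin n → F` along a ring homomorphism
`f : F → K`. -/
noncomputable def extendQF {K : Type} [CommRing K] (f : F →+* K) {n : ℕ}
    (φ : QuadraticForm F (Fin n → F)) : QuadraticForm K (Fin n → K) :=
  ((coeffMat F φ).map f).toQuadraticMap'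

end FunField


section Quat

variable (K : Type) [CommRing K]

/-- Defining relations for the char-2 quaternion algebra `[a,b)`: generators `i,j` with
`i² + i = a`, `j² = b`, `j·i = i·j + j` (i.e. `j·i·j⁻¹ = i + 1`). -/
inductive QuatRel (a b : K) : FreeAlgebra K (Fin 2) → FreeAlgebra K (Fin 2) → Prop
  | i_sq : QuatRel a b (FreeAlgebra.ι K 0 * FreeAlgebra.ι K 0 + FreeAlgebra.ι K 0)
      (algebraMap K _ a)
  | j_sq : QuatRel a b (FreeAlgebra.ι K 1 * FreeAlgebra.ι K 1) (algebraMap K _ b)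
  | swap : QuatRel a b (FreeAlgebra.ι K 1 * FreeAlgebra.ι K 0)
      (FreeAlgebra.ι K 0 * FreeAlgebra.ι K 1 + FreeAlgebra.ι K 1)

/-- The quaternion algebra `[a,b)` over `K` (characteristic two convention). -/
def QuatAlg (a b : K) : Type := RingQuot (QuatRel K a b)

noncomputable instance (a b : K) : Ring (QuatAlg K a b) :=
  inferInstanceAs (Ring (RingQuot (QuatRel K a b)))
noncomputable instance (a b : K) : Algebra K (QuatAlg K a b) :=
  inferInstanceAs (Algebra K (RingQuot (QuatRel K a b)))

/-- `[a,b)` is split over `K`: isomorphic to the `2×2` matrix algebra. -/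
def QuatSplit (a b : K) : Prop :=
  Nonempty (QuatAlg K a b ≃ₐ[K] Matrix (Fin 2) (Fin 2) K)

end Quat

section Sqrt

variable (F : Type) [Field F]

/-- The field `F(√c₁,…,√c_s)` obtained by adjoining square roots of the `cᵢ`
(inside an algebraic closure of `F`). -/
noncomputable def sqrtExt {s : ℕ} (c : Fin s → F) :
    IntermediateField F (AlgebraicClosure F) :=
  IntermediateField.adjoin F
    {y : AlgebraicClosure F | ∃ i, y ^ 2 = algebraMap F (AlgebraicClosure F) (c i)}

/-- The subfield `F² = {x² : x ∈ F}` of squares of a field of characteristic 2. -/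
noncomputable def sqSubfield : Subfield F := Subfield.closure (Set.range fun x : F => x ^ 2)

set_option synthInstance.maxHeartbeats 1000000 in
/-- The norm degree `[F²(cᵢ·cⱼ) : F²]` of a diagonal form `⟨c₁,…,c_s⟩`. -/
noncomputable def normDegree {s : ℕ} (c : Fin s → F) : ℕ :=
  Module.finrank (sqSubfield F)
    (IntermediateField.adjoin (sqSubfield F)
      (Set.range fun p : Fin s × Fin s => c p.1 * c p.2))

end Sqrt

/-- A ring is a division algebra if it is nontrivial and every nonzero element is a unit. -/
def IsDivisionAlgebra (T : Type) [Ring T] : Prop :=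
  (0 : T) ≠ 1 ∧ ∀ x : T, x ≠ 0 → IsUnit x


section Norm

/-- In a domain with an involution `τ`, a unit `e` with `e · aτ(a) = bτ(b)`, where `a` and `b` have
a greatest common divisor in the strong sense, is the norm `uτ(u)` of a unit. -/
lemma exists_isUnit_eq_mul_of_mul_norm_eq_norm {R : Type*} [CommRing R] [IsDomain R]
    (τ : R →+* R) (hτ : ∀ x, τ (τ x) = x) {e a b : R} (he : IsUnit e)
    (hcop : ∃ d A B, a = d * A ∧ b = d * B ∧ IsCoprime A B) (hb : b ≠ 0)
    (h : e * (a * τ a) = b * τ b) : ∃ u, IsUnit u ∧ e = u * τ u := by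
  obtain ⟨d, A, B, rfl, rfl, hAB⟩ := hcop
  have hτinj : Function.Injective τ := Function.LeftInverse.injective hτ
  have hd : d ≠ 0 := left_ne_zero_of_mul hb
  have hB : B ≠ 0 := right_ne_zero_of_mul hb
  have hτ0 : ∀ {x}, x ≠ 0 → τ x ≠ 0 := fun hx => (map_ne_zero_iff τ hτinj).2 hx
  have h1 : e * (A * τ A) = B * τ B := by
    refine mul_left_cancel₀ (mul_ne_zero hd (hτ0 hd)) ?_
    simp only [map_mul] at h
    linear_combination h
  have hA : A ≠ 0 := by
    rintro rfl
    simp only [zero_mul, mul_zero] at h1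
    exact mul_ne_zero hB (hτ0 hB) h1.symm
  have hdvd1 : A ∣ τ B := hAB.dvd_of_dvd_mul_left ⟨e * τ A, by rw [← h1]; ring⟩
  have hdvd2 : τ B ∣ A := by
    have hc : IsCoprime (τ B) (τ A) := (hAB.map τ).symm
    have h2 : τ B ∣ (e * A) * τ A := ⟨B, by linear_combination h1⟩
    exact (he.dvd_mul_left).1 (hc.dvd_of_dvd_mul_right h2)
  obtain ⟨u, hu⟩ := associated_of_dvd_dvd hdvd1 hdvd2
  refine ⟨u, u.isUnit, ?_⟩
  have h3 : B = τ A * τ u := by rw [← map_mul, hu, hτ]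
  refine mul_left_cancel₀ (mul_ne_zero hA (hτ0 hA)) ?_
  have h4 : B * τ B = τ A * τ u * (A * u) := by rw [hu, ← h3]
  linear_combination h1 + h4

end Norm

section Laurent

open LaurentPolynomial

variable {L : Type*} [Field L]

instance : IsDomain L[T;T⁻¹] :=
  IsLocalization.isDomain_of_le_nonZeroDivisors (R := Polynomial L)
    (M := Submonoid.powers (Polynomial.X : Polynomial L)) _
    (powers_le_nonZeroDivisors_of_noZeroDivisors Polynomial.X_ne_zero)

lemma LaurentPolynomial.exists_eq_toLaurent_mul_T (f : L[T;T⁻¹]) :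
    ∃ (n : ℕ) (g : Polynomial L), f = Polynomial.toLaurent g * T (-n) := by
  obtain ⟨n, g, hg⟩ := f.exists_T_pow
  exact ⟨n, g, by rw [hg, mul_T_assoc, add_neg_cancel, T_zero, mul_one]⟩

lemma LaurentPolynomial.exists_isCoprime (a : L[T;T⁻¹]) {b : L[T;T⁻¹]} (hb : b ≠ 0) :
    ∃ d A B, a = d * A ∧ b = d * B ∧ IsCoprime A B := by
  classical
  obtain ⟨m, f, rfl⟩ := a.exists_eq_toLaurent_mul_T
  obtain ⟨n, g, rfl⟩ := b.exists_eq_toLaurent_mul_T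
  have hg : g ≠ 0 := by
    rintro rfl
    simp at hb
  have hc := (isCoprime_div_gcd_div_gcd (p := f) hg).map Polynomial.toLaurent
  set d := GCDMonoid.gcd f g
  have h1 : f = d * (f / d) :=
    (EuclideanDomain.mul_div_cancel' (gcd_ne_zero_of_right hg) (gcd_dvd_left f g)).symm
  have h2 : g = d * (g / d) :=
    (EuclideanDomain.mul_div_cancel' (gcd_ne_zero_of_right hg) (gcd_dvd_right f g)).symm
  refine ⟨Polynomial.toLaurent d, Polynomial.toLaurent (f / d) * T (-m),
    Polynomial.toLaurent (g / d) * T (-n), ?_, ?_, ?_⟩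
  · rw [← mul_assoc, ← map_mul, ← h1]
  · rw [← mul_assoc, ← map_mul, ← h2]
  · rwa [isCoprime_mul_unit_right_left (isUnit_T _), isCoprime_mul_unit_right_right (isUnit_T _)]

lemma LaurentPolynomial.exists_eq_C_mul_T_of_isUnit {u : L[T;T⁻¹]} (hu : IsUnit u) :
    ∃ (l : L) (k : ℤ), l ≠ 0 ∧ u = C l * T k := by
  obtain ⟨v, huv⟩ := hu.exists_right_inv
  obtain ⟨m, f, rfl⟩ := u.exists_eq_toLaurent_mul_T
  obtain ⟨n, g, rfl⟩ := v.exists_eq_toLaurent_mul_T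
  have h : f * g = Polynomial.X ^ (m + n) := by
    apply Polynomial.toLaurent_injective
    rw [Polynomial.toLaurent_X_pow, map_mul]
    calc _ = Polynomial.toLaurent f * Polynomial.toLaurent g * (T (-m) * T (-n) * T (m + n)) := by
            rw [← T_add, ← T_add, show (-m + -n + (m + n) : ℤ) = 0 by ring, T_zero, mul_one]
      _ = (Polynomial.toLaurent f * T (-m) * (Polynomial.toLaurent g * T (-n))) * T (m + n) := by
            ring
      _ = T (m + n : ℕ) := by rw [huv, one_mul]; push_cast; rfl
  obtain ⟨i, -, hi⟩ := (dvd_prime_pow Polynomial.prime_X _).1 ⟨g, h.symm⟩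
  obtain ⟨w, hw⟩ := hi.symm
  obtain ⟨l, hl, hlw⟩ := Polynomial.isUnit_iff.1 w.isUnit
  refine ⟨l, i - m, hl.ne_zero, ?_⟩
  rw [← hw, ← hlw, map_mul, Polynomial.toLaurent_X_pow, Polynomial.toLaurent_C, T_sub]
  ring

/-- The ring endomorphism of `L[T;T⁻¹]` acting by `β` on coefficients, with `T ↦ ρT⁻¹`. -/
noncomputable def laurentSwap (β : L →+* L) (ρ : Lˣ) : L[T;T⁻¹] →+* L[T;T⁻¹] :=
  LaurentPolynomial.eval₂ (LaurentPolynomial.C.comp β)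
    (Units.map (LaurentPolynomial.C : L →+* L[T;T⁻¹]).toMonoidHom ρ *
      ((isUnit_T 1).unit : (L[T;T⁻¹])ˣ)⁻¹)

lemma laurentSwap_C (β : L →+* L) (ρ : Lˣ) (l : L) : laurentSwap β ρ (LaurentPolynomial.C l) =
    LaurentPolynomial.C (β l) := by
  simp [laurentSwap]

lemma laurentSwap_T (β : L →+* L) (ρ : Lˣ) (k : ℤ) :
    laurentSwap β ρ (T k) = LaurentPolynomial.C ((ρ ^ k : Lˣ) : L) * T (-k) := by
  have h : (((isUnit_T 1).unit : (L[T;T⁻¹])ˣ)⁻¹) =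
      ⟨T (-1), T 1, by rw [← T_add]; simp, by rw [← T_add]; simp⟩ := by
    rw [inv_eq_iff_eq_inv]
    ext
    simp
  have h2 : ∀ n : ℕ, laurentSwap β ρ (T n) = LaurentPolynomial.C ((ρ ^ n : Lˣ) : L) * T (-n) := by
    intro n
    rw [laurentSwap, eval₂_T_n, h]
    simp [mul_pow, T_pow]
  obtain ⟨n, rfl | rfl⟩ := k.eq_nat_or_neg
  · simpa using h2 n
  · have h3 : laurentSwap β ρ (T n) * laurentSwap β ρ (T (-n)) = 1 := by
      rw [← map_mul, ← T_add]; simp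
    have h4 : (LaurentPolynomial.C ((ρ ^ n : Lˣ) : L) * T (-n) : L[T;T⁻¹]) *
        (LaurentPolynomial.C ((ρ ^ (-n : ℤ) : Lˣ) : L) * T (-(-n))) = 1 := by
      rw [mul_mul_mul_comm, ← map_mul, ← T_add, ← Units.val_mul]
      simp
    rw [h2] at h3
    exact mul_left_cancel₀ (left_ne_zero_of_mul_eq_one h3) (h3.trans h4.symm)

lemma laurentSwap_involutive {β : L →+* L} (hβ : ∀ x, β (β x) = x) {ρ : Lˣ} (hρ : β ρ = ρ)
    (f : L[T;T⁻¹]) : laurentSwap β ρ (laurentSwap β ρ f) = f := by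
  have hρ' : ∀ k : ℤ, β ((ρ ^ k : Lˣ) : L) = ((ρ ^ k : Lˣ) : L) := by
    intro k
    simp [hρ]
  induction f using LaurentPolynomial.induction_on' with
  | add p q hp hq => rw [map_add, map_add, hp, hq]
  | C_mul_T k a =>
    have h : LaurentPolynomial.C ((ρ ^ k : Lˣ) : L) * LaurentPolynomial.C ((ρ ^ (-k) : Lˣ) : L) =
        1 := by
      rw [← map_mul, ← Units.val_mul]
      simp
    rw [map_mul, map_mul, laurentSwap_C, laurentSwap_C, laurentSwap_T, map_mul, laurentSwap_C,
      laurentSwap_T, hβ, hρ', neg_neg]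
    linear_combination LaurentPolynomial.C a * T k * h

end Laurent

section LaurentY

open LaurentPolynomial

variable {L : Type*} [Field L]

/-- The element `T + ρT⁻¹`. -/
noncomputable def laurentY (ρ : Lˣ) : L[T;T⁻¹] := T 1 + LaurentPolynomial.C (ρ : L) * T (-1)

lemma laurentSwap_laurentY {β : L →+* L} {ρ : Lˣ} (hρ : β ρ = ρ) :
    laurentSwap β ρ (laurentY ρ) = laurentY ρ := by
  have h : LaurentPolynomial.C ((ρ : L)) * LaurentPolynomial.C ((ρ ^ (-1 : ℤ) : Lˣ) : L) = 1 := by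
    rw [← map_mul, ← Units.val_mul]
    simp
  rw [laurentY, map_add, map_mul, laurentSwap_C, laurentSwap_T, laurentSwap_T, hρ, neg_neg,
    zpow_one]
  linear_combination T 1 * h

lemma eval₂_laurentY_injective (ρ : Lˣ) :
    Function.Injective (Polynomial.eval₂ (LaurentPolynomial.C : L →+* L[T;T⁻¹]) (laurentY ρ)) := by
  rw [← Polynomial.coe_eval₂RingHom, injective_iff_map_eq_zero]
  intro g hg
  by_contra hg0
  have hY : IsIntegral L (laurentY ρ) :=
    isAlgebraic_iff_isIntegral.1 ⟨g, hg0, by rw [Polynomial.aeval_def]; exact hg⟩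
  let S := Algebra.adjoin L {laurentY ρ}
  have : Algebra.IsIntegral L S := by
    rw [← le_integralClosure_iff_isIntegral, Algebra.adjoin_le_iff]
    simpa [mem_integralClosure_iff] using hY
  let y : S := ⟨laurentY ρ, Algebra.subset_adjoin rfl⟩
  have hT : IsIntegral S (T 1 : L[T;T⁻¹]) := by
    refine ⟨Polynomial.X ^ 2 - Polynomial.C y * Polynomial.X + Polynomial.C (algebraMap L S ρ),
      by monicity!, ?_⟩
    have h1 : (T 1 * T (-1) : L[T;T⁻¹]) = 1 := by rw [← T_add]; simp
    have h2 : algebraMap S L[T;T⁻¹] y = laurentY ρ := rfl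
    have h3 : algebraMap S L[T;T⁻¹] (algebraMap L S ρ) = LaurentPolynomial.C (ρ : L) := rfl
    simp only [Polynomial.eval₂_add, Polynomial.eval₂_sub, Polynomial.eval₂_mul,
      Polynomial.eval₂_pow, Polynomial.eval₂_X, Polynomial.eval₂_C, h2, h3, laurentY]
    linear_combination -LaurentPolynomial.C (ρ : L) * h1
  obtain ⟨p, hp, hpT⟩ := isIntegral_trans (R := L) _ hT
  have h4 : Polynomial.toLaurent p = 0 := by
    rw [← hpT]
    have h5 : (Polynomial.toLaurent : Polynomial L →+* L[T;T⁻¹]) =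
        Polynomial.eval₂RingHom (LaurentPolynomial.C : L →+* L[T;T⁻¹]) (T 1) :=
      Polynomial.ringHom_ext (by simp) (by simp)
    exact RingHom.congr_fun h5 p
  exact hp.ne_zero (Polynomial.toLaurent_injective (by simpa using h4))

variable [CharP L 2]

lemma two_laurent_eq_zero : (2 : L[T;T⁻¹]) = 0 := by
  have h := congrArg (LaurentPolynomial.C : L →+* L[T;T⁻¹]) (CharTwo.two_eq_zero (R := L))
  rwa [map_zero, map_ofNat] at h

/-- The root `a⁻¹(T + ωY)` of the quadratic polynomial `aX² + YX + bY² + a⁻¹ρ`, where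
`Y = T + ρT⁻¹` and `ω² + ω = ab`. -/
noncomputable def laurentRoot (ρ : Lˣ) (a ω : L) : L[T;T⁻¹] :=
  LaurentPolynomial.C a⁻¹ * (T 1 + LaurentPolynomial.C ω * laurentY ρ)

lemma laurentRoot_eq {ρ : Lˣ} {a b c ω : L} (ha : a ≠ 0) (hω : ω ^ 2 + ω = a * b)
    (hρ : (ρ : L) = a * c) :
    LaurentPolynomial.C a * laurentRoot ρ a ω ^ 2 + laurentRoot ρ a ω * laurentY ρ +
      (LaurentPolynomial.C b * laurentY ρ ^ 2 + LaurentPolynomial.C c) = 0 := by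
  have h2 : (2 : L[T;T⁻¹]) = 0 := two_laurent_eq_zero
  have h1 : (T 1 * T (-1) : L[T;T⁻¹]) = 1 := by rw [← T_add]; simp
  have h3 : (LaurentPolynomial.C a * LaurentPolynomial.C a⁻¹ : L[T;T⁻¹]) = 1 := by
    rw [← map_mul, mul_inv_cancel₀ ha, map_one]
  have h4 : (LaurentPolynomial.C ω ^ 2 + LaurentPolynomial.C ω : L[T;T⁻¹]) =
      LaurentPolynomial.C a * LaurentPolynomial.C b := by
    rw [← map_pow, ← map_add, hω, map_mul]
  have h5 : (T 1 : L[T;T⁻¹]) ^ 2 + T 1 * laurentY ρ =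
      LaurentPolynomial.C a * LaurentPolynomial.C c := by
    rw [← map_mul, ← hρ, laurentY]
    linear_combination T 1 ^ 2 * h2 + LaurentPolynomial.C (ρ : L) * h1
  have h6 : LaurentPolynomial.C a * laurentRoot ρ a ω = T 1 + LaurentPolynomial.C ω * laurentY ρ :=
      by
    rw [laurentRoot, ← mul_assoc, h3, one_mul]
  have hC : (LaurentPolynomial.C a : L[T;T⁻¹]) ≠ 0 := left_ne_zero_of_mul_eq_one h3
  refine mul_left_cancel₀ hC ?_
  rw [mul_zero]
  generalize laurentRoot ρ a ω = x at *
  linear_combination (LaurentPolynomial.C a * x + T 1 + LaurentPolynomial.C ω * laurentY ρ +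
    laurentY ρ) * h6 + h5 + h4 * laurentY ρ ^ 2 +
    (LaurentPolynomial.C a * LaurentPolynomial.C b * laurentY ρ ^ 2 +
    LaurentPolynomial.C a * LaurentPolynomial.C c + T 1 * LaurentPolynomial.C ω * laurentY ρ) * h2

lemma laurentSwap_laurentRoot {β : L →+* L} {ρ : Lˣ} (hρ : β ρ = ρ) {a ω : L} (ha : β a = a)
    (hω : β ω = ω + 1) :
    laurentSwap β ρ (laurentRoot ρ a ω) = laurentRoot ρ a ω := by
  have h2 : (2 : L[T;T⁻¹]) = 0 := two_laurent_eq_zero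
  rw [laurentRoot, map_mul, map_add, map_mul, laurentSwap_C, laurentSwap_C, laurentSwap_T,
    laurentSwap_laurentY hρ, map_inv₀, ha, hω, map_add, map_one, zpow_one, laurentY]
  linear_combination LaurentPolynomial.C a⁻¹ * LaurentPolynomial.C (ρ : L) * T (-1) * h2

lemma laurentSwap_id_laurentRoot (ρ : Lˣ) (a ω : L) :
    laurentSwap (RingHom.id L) ρ (laurentRoot ρ a ω) =
      laurentRoot ρ a ω + LaurentPolynomial.C a⁻¹ * laurentY ρ := by
  have h2 : (2 : L[T;T⁻¹]) = 0 := two_laurent_eq_zero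
  rw [laurentRoot, map_mul, map_add, map_mul, laurentSwap_C, laurentSwap_C, laurentSwap_T,
    laurentSwap_laurentY rfl, zpow_one]
  simp only [RingHom.id_apply]
  rw [laurentY]
  linear_combination -LaurentPolynomial.C a⁻¹ * T 1 * h2

lemma eq_zero_of_eval₂_laurentY_mul_laurentRoot_add (ρ : Lˣ) {a : L} (ha : a ≠ 0) (ω : L)
    {u w : Polynomial L}
    (h : u.eval₂ LaurentPolynomial.C (laurentY ρ) * laurentRoot ρ a ω +
      w.eval₂ LaurentPolynomial.C (laurentY ρ) = 0) : u = 0 ∧ w = 0 := by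
  have hinj := eval₂_laurentY_injective ρ
  have hfix : ∀ v : Polynomial L, laurentSwap (RingHom.id L) ρ
      (v.eval₂ LaurentPolynomial.C (laurentY ρ)) = v.eval₂ LaurentPolynomial.C (laurentY ρ) := by
    intro v
    rw [Polynomial.hom_eval₂, laurentSwap_laurentY rfl]
    congr 1
    ext1 x
    simp [laurentSwap_C]
  have h1 := congrArg (laurentSwap (RingHom.id L) ρ) h
  rw [map_add, map_mul, hfix, hfix, laurentSwap_id_laurentRoot, map_zero] at h1
  have hY : laurentY ρ ≠ 0 := by
    intro h0
    refine Polynomial.X_ne_zero (R := L) (hinj ?_)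
    simp [h0]
  have hC : (LaurentPolynomial.C a⁻¹ : L[T;T⁻¹]) ≠ 0 := by simpa using ha
  have h2 : u.eval₂ LaurentPolynomial.C (laurentY ρ) *
      (LaurentPolynomial.C a⁻¹ * laurentY ρ) = 0 := by
    linear_combination h1 - h
  have hu : u = 0 := hinj (by
    simpa using (mul_eq_zero.1 h2).resolve_right (mul_ne_zero hC hY))
  subst hu
  exact ⟨rfl, hinj (by simpa using h)⟩

variable {A : Type*} [CommRing A]

/-- The polynomial `aT² + TY + bY² + c` in `A[Y][T]`. -/
noncomputable def quadYT (a b c : A) : Polynomial (Polynomial A) :=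
  Polynomial.C (Polynomial.C a) * Polynomial.X ^ 2 + Polynomial.C Polynomial.X * Polynomial.X +
    Polynomial.C (Polynomial.C b * Polynomial.X ^ 2 + Polynomial.C c)

/-- Evaluation of polynomials in `A[Y][T]` at the generic point of `quadYT`. -/
noncomputable def evalYT (f : A →+* L) (ρ : Lˣ) (a ω : L) :
    Polynomial (Polynomial A) →+* L[T;T⁻¹] :=
  Polynomial.eval₂RingHom (Polynomial.eval₂RingHom (LaurentPolynomial.C.comp f) (laurentY ρ))
    (laurentRoot ρ a ω)

lemma evalYT_quadYT (f : A →+* L) {ρ : Lˣ} {a b c : A} {ω : L} (ha : f a ≠ 0)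
    (hω : ω ^ 2 + ω = f a * f b) (hρ : (ρ : L) = f a * f c) :
    evalYT f ρ (f a) ω (quadYT a b c) = 0 := by
  simp only [evalYT, quadYT, Polynomial.coe_eval₂RingHom, Polynomial.eval₂_add,
    Polynomial.eval₂_mul, Polynomial.eval₂_pow, Polynomial.eval₂_X, Polynomial.eval₂_C,
    RingHom.comp_apply]
  linear_combination laurentRoot_eq ha hω hρ

lemma laurentSwap_evalYT (f : A →+* L) {β : L →+* L} {ρ : Lˣ} (hρ : β ρ = ρ) {a ω : L}
    (ha : β a = a) (hω : β ω = ω + 1) (hf : ∀ x, β (f x) = f x) (p : Polynomial (Polynomial A)) :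
    laurentSwap β ρ (evalYT f ρ a ω p) = evalYT f ρ a ω p := by
  rw [← RingHom.comp_apply]
  congr 1
  refine Polynomial.ringHom_ext' (Polynomial.ringHom_ext' ?_ ?_) ?_
  · ext1 x
    simp [evalYT, laurentSwap_C, hf]
  · simp [evalYT, laurentSwap_laurentY hρ]
  · simp [evalYT, laurentSwap_laurentRoot hρ ha hω]

/-- If `1, s₂, s₃ ∈ L` are linearly independent over `A`, then so are they over
`A[Y][T]/(quadYT)`. -/
lemma quadYT_dvd_of_evalYT_add_eq_zero [Nontrivial A] (f : A →+* L) {ρ : Lˣ} {a b c : A} {ω : L}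
    (ha : IsUnit a)
    (hω : ω ^ 2 + ω = f a * f b) (hρ : (ρ : L) = f a * f c) {s t : L}
    (hst : ∀ x y z : A, f x + s * f y + t * f z = 0 → x = 0 ∧ y = 0 ∧ z = 0)
    {p q r : Polynomial (Polynomial A)}
    (h : evalYT f ρ (f a) ω p + LaurentPolynomial.C s * evalYT f ρ (f a) ω q +
      LaurentPolynomial.C t * evalYT f ρ (f a) ω r = 0) :
    quadYT a b c ∣ p ∧ quadYT a b c ∣ q ∧ quadYT a b c ∣ r := by
  have hfa : f a ≠ 0 := (ha.map f).ne_zero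
  obtain ⟨a', ha'⟩ := ha.exists_right_inv
  set g := Polynomial.C (Polynomial.C a') * quadYT a b c with hg
  have hgd : quadYT a b c ∣ g := Dvd.intro_left _ rfl
  have hgm : g.Monic := by
    have : g = Polynomial.X ^ 2 + (Polynomial.C (Polynomial.C a' * Polynomial.X) * Polynomial.X +
        Polynomial.C (Polynomial.C a' * (Polynomial.C b * Polynomial.X ^ 2 + Polynomial.C c))) := by
      have h1 : (Polynomial.C (Polynomial.C a) * Polynomial.C (Polynomial.C a') :
          Polynomial (Polynomial A)) = 1 := by
        rw [← map_mul, ← map_mul, ha', map_one, map_one]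
      rw [hg, quadYT]
      simp only [map_mul, map_add]
      linear_combination Polynomial.X ^ 2 * h1
    rw [this]
    monicity!
  have hgdeg : g.natDegree ≤ 2 := by
    rw [hg, quadYT]
    compute_degree
  have key : ∀ p : Polynomial (Polynomial A), ∃ u w : Polynomial A,
      p %ₘ g = Polynomial.C u * Polynomial.X + Polynomial.C w ∧
      evalYT f ρ (f a) ω p =
        (u.map f).eval₂ LaurentPolynomial.C (laurentY ρ) * laurentRoot ρ (f a) ω +
          (w.map f).eval₂ LaurentPolynomial.C (laurentY ρ) := by
    intro p
    have h1 : (p %ₘ g).natDegree ≤ 1 := by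
      by_cases h1 : g = 1
      · simp [h1]
      · have := Polynomial.natDegree_modByMonic_lt p hgm h1
        lia
    have h3 := Polynomial.eq_X_add_C_of_natDegree_le_one h1
    refine ⟨_, _, h3, ?_⟩
    have h4 := congrArg (evalYT f ρ (f a) ω) (Polynomial.modByMonic_add_div p g)
    rw [← h4, map_add, map_mul, hg, map_mul, evalYT_quadYT f hfa hω hρ, mul_zero, zero_mul,
      add_zero, ← hg, h3]
    simp [evalYT, Polynomial.eval₂_map]
  obtain ⟨u, w, hp, hp'⟩ := key p
  obtain ⟨u', w', hq, hq'⟩ := key q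
  obtain ⟨u'', w'', hr, hr'⟩ := key r
  have hz := eq_zero_of_eval₂_laurentY_mul_laurentRoot_add ρ hfa ω
    (u := u.map f + Polynomial.C s * u'.map f + Polynomial.C t * u''.map f)
    (w := w.map f + Polynomial.C s * w'.map f + Polynomial.C t * w''.map f) (by
      rw [hp', hq', hr'] at h
      simp only [Polynomial.eval₂_add, Polynomial.eval₂_mul, Polynomial.eval₂_C]
      linear_combination h)
  have key2 : ∀ u u' u'' : Polynomial A,
      u.map f + Polynomial.C s * u'.map f + Polynomial.C t * u''.map f = 0 →
      u = 0 ∧ u' = 0 ∧ u'' = 0 := by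
    intro u u' u'' h
    have h5 : ∀ n, u.coeff n = 0 ∧ u'.coeff n = 0 ∧ u''.coeff n = 0 := by
      intro n
      apply hst
      simpa using congrArg (Polynomial.coeff · n) h
    exact ⟨Polynomial.ext fun n => (h5 n).1, Polynomial.ext fun n => (h5 n).2.1,
      Polynomial.ext fun n => (h5 n).2.2⟩
  obtain ⟨rfl, rfl, rfl⟩ := key2 _ _ _ hz.1
  obtain ⟨rfl, rfl, rfl⟩ := key2 _ _ _ hz.2
  simp only [map_zero, zero_mul, add_zero, Polynomial.modByMonic_eq_zero_iff_dvd hgm] at hp hq hr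
  exact ⟨hgd.trans hp, hgd.trans hq, hgd.trans hr⟩

end LaurentY

section TernaryAniso

/-- The form `[a,b] ⊥ ⟨1⟩` has no nontrivial zero with entries in the ring `A`. -/
def TernaryAniso {A : Type*} [CommRing A] (a b : A) : Prop :=
  ∀ x y z : A, a * x ^ 2 + x * y + b * y ^ 2 + z ^ 2 = 0 → x = 0 ∧ y = 0 ∧ z = 0

variable {A : Type*} [CommRing A] {a b : A}

lemma TernaryAniso.mvPolynomial [IsDomain A] [Infinite A] (h : TernaryAniso a b) (κ : Type*) :
    TernaryAniso (MvPolynomial.C a : MvPolynomial κ A) (MvPolynomial.C b) := by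
  intro x y z hxyz
  have h1 : ∀ v, eval v x = 0 ∧ eval v y = 0 ∧ eval v z = 0 := fun v =>
    h _ _ _ (by simpa using congrArg (eval v) hxyz)
  exact ⟨MvPolynomial.funext fun v => by simp [(h1 v).1],
    MvPolynomial.funext fun v => by simp [(h1 v).2.1],
    MvPolynomial.funext fun v => by simp [(h1 v).2.2]⟩

lemma TernaryAniso.polynomial [IsDomain A] [Infinite A] (h : TernaryAniso a b) :
    TernaryAniso (Polynomial.C a) (Polynomial.C b) := by
  intro x y z hxyz
  have h1 : ∀ v, x.eval v = 0 ∧ y.eval v = 0 ∧ z.eval v = 0 := fun v =>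
    h _ _ _ (by simpa using congrArg (Polynomial.eval v) hxyz)
  exact ⟨Polynomial.funext fun v => by simp [(h1 v).1],
    Polynomial.funext fun v => by simp [(h1 v).2.1],
    Polynomial.funext fun v => by simp [(h1 v).2.2]⟩

lemma TernaryAniso.localization (h : TernaryAniso a b) (S : Submonoid A)
    (hS : S ≤ nonZeroDivisors A) (B : Type*) [CommRing B] [Algebra A B] [IsLocalization S B] :
    TernaryAniso (algebraMap A B a) (algebraMap A B b) := by
  classical
  intro x y z hxyz
  obtain ⟨d, hd⟩ := IsLocalization.exist_integer_multiples_of_finset S ({x, y, z} : Finset B)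
  obtain ⟨x', hx⟩ := hd x (by simp)
  obtain ⟨y', hy⟩ := hd y (by simp)
  obtain ⟨z', hz⟩ := hd z (by simp)
  rw [Algebra.smul_def] at hx hy hz
  have hdu : IsUnit (algebraMap A B d) := IsLocalization.map_units B d
  have h1 := h x' y' z' (IsLocalization.injective B hS (by
    simp only [map_add, map_mul, map_pow, map_zero, hx, hy, hz]
    linear_combination (algebraMap A B d) ^ 2 * hxyz))
  obtain ⟨rfl, rfl, rfl⟩ := h1
  simp only [map_zero] at hx hy hz
  exact ⟨(hdu.mul_right_eq_zero).1 hx.symm, (hdu.mul_right_eq_zero).1 hy.symm,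
    (hdu.mul_right_eq_zero).1 hz.symm⟩

/-- The fraction field of `M[κ][X]`. -/
abbrev RatField (M κ : Type*) [Field M] : Type _ :=
  FractionRing (Polynomial (MvPolynomial κ M))

/-- The embedding of the constants. -/
noncomputable def ratConst (M κ : Type*) [Field M] : M →+* RatField M κ :=
  (algebraMap (Polynomial (MvPolynomial κ M)) (RatField M κ)).comp
    (Polynomial.C.comp MvPolynomial.C)

open LaurentPolynomial in
lemma TernaryAniso.laurent {M : Type*} [Field M] [Infinite M] {a b : M} (h : TernaryAniso a b)
    (κ : Type*) :
    TernaryAniso (LaurentPolynomial.C (ratConst M κ a) : (RatField M κ)[T;T⁻¹])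
      (LaurentPolynomial.C (ratConst M κ b)) := by
  have : Infinite (MvPolynomial κ M) := .of_injective _ (MvPolynomial.C_injective κ M)
  have : Infinite (RatField M κ) := .of_injective _ (ratConst M κ).injective
  have h1 := ((h.mvPolynomial κ).polynomial.localization (nonZeroDivisors _) le_rfl
    (RatField M κ)).polynomial.localization
      (Submonoid.powers (Polynomial.X : Polynomial (RatField M κ)))
      (powers_le_nonZeroDivisors_of_noZeroDivisors Polynomial.X_ne_zero) ((RatField M κ)[T;T⁻¹])
  rw [algebraMap_eq_toLaurent, algebraMap_eq_toLaurent, Polynomial.toLaurent_C,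
    Polynomial.toLaurent_C] at h1
  exact h1

end TernaryAniso

section Parity

variable {M κ : Type*} [Field M]

/-- The action on `M[κ][X]` of an endomorphism of `M`. -/
noncomputable def polyMap (κ : Type*) (σ : M →+* M) :
    Polynomial (MvPolynomial κ M) →+* Polynomial (MvPolynomial κ M) :=
  Polynomial.mapRingHom (MvPolynomial.map σ)

lemma polyMap_polyMap {σ : M →+* M} (hσ : ∀ x, σ (σ x) = x) (p : Polynomial (MvPolynomial κ M)) :
    polyMap κ σ (polyMap κ σ p) = p := by
  have h : σ.comp σ = RingHom.id M := RingHom.ext hσ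
  simp only [polyMap, Polynomial.coe_mapRingHom, Polynomial.map_map]
  have h2 : (MvPolynomial.map (σ := κ) σ).comp (MvPolynomial.map σ) = RingHom.id _ := by
    refine RingHom.ext fun x => ?_
    simp [MvPolynomial.map_map, h, MvPolynomial.map_id]
  rw [h2, Polynomial.map_id]

lemma polyMap_injective (κ : Type*) (σ : M →+* M) : Function.Injective (polyMap κ σ) :=
  Polynomial.map_injective _ (MvPolynomial.map_injective _ σ.injective)

/-- The action on the field `M(κ, X)` of an endomorphism of `M`. -/
noncomputable def ratMap (κ : Type*) (σ : M →+* M) : RatField M κ →+* RatField M κ :=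
  IsFractionRing.map (polyMap_injective κ σ)

lemma ratMap_algebraMap (σ : M →+* M) (p : Polynomial (MvPolynomial κ M)) :
    ratMap κ σ (algebraMap _ _ p) = algebraMap _ _ (polyMap κ σ p) := by
  rw [ratMap, IsFractionRing.map, IsLocalization.map_eq]

lemma ratMap_ratMap {σ : M →+* M} (hσ : ∀ x, σ (σ x) = x) (x : RatField M κ) :
    ratMap κ σ (ratMap κ σ x) = x := by
  obtain ⟨p, q, -, rfl⟩ := IsFractionRing.div_surjective (A := Polynomial (MvPolynomial κ M)) x
  simp only [map_div₀, ratMap_algebraMap, polyMap_polyMap hσ]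

lemma polyMap_C_C (σ : M →+* M) (m : M) :
    polyMap κ σ (Polynomial.C (MvPolynomial.C m)) = Polynomial.C (MvPolynomial.C (σ m)) := by
  simp [polyMap]

lemma exists_mul_norm_eq_one {F : Type*} [Field F] [Infinite F] {ι : F →+* M} {σ : M →+* M}
    (hσF : ∀ x : F, σ (ι x) = ι x) {e : M}
    {p q : Polynomial (MvPolynomial κ M)} (hp : p ≠ 0) (hq : q ≠ 0)
    (h : Polynomial.C (MvPolynomial.C e) * (p * polyMap κ σ p) = q * polyMap κ σ q) :
    ∃ m, e * (m * σ m) = 1 := by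
  have hpq : p * q ≠ 0 := mul_ne_zero hp hq
  have h1 : ∃ t : F, (p * q).eval (MvPolynomial.C (ι t)) ≠ 0 := by
    by_contra! hc
    refine hpq (Polynomial.eq_zero_of_infinite_isRoot _ (Set.Infinite.mono ?_
      (Set.infinite_range_of_injective (f := fun t : F =>
        (MvPolynomial.C (ι t) : MvPolynomial κ M))
        ((MvPolynomial.C_injective κ M).comp ι.injective))))
    rintro _ ⟨t, rfl⟩
    exact hc t
  obtain ⟨t, ht⟩ := h1
  have h2 : ∃ v : κ → F, eval (fun i => ι (v i))
      ((p * q).eval (MvPolynomial.C (ι t))) ≠ 0 := by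
    by_contra! hc
    refine ht (MvPolynomial.funext_set (fun _ => Set.range ι)
      (fun _ => Set.infinite_range_of_injective ι.injective) fun x hx => ?_)
    choose v hv using fun i => hx i (Set.mem_univ i)
    have : x = fun i => ι (v i) := _root_.funext fun i => (hv i).symm
    rw [this, hc, map_zero]
  obtain ⟨v, hv⟩ := h2
  let ev : Polynomial (MvPolynomial κ M) →+* M :=
    (eval (fun i => ι (v i))).comp
      (Polynomial.evalRingHom (MvPolynomial.C (ι t)))
  have hev : ∀ p, ev (polyMap κ σ p) = σ (ev p) := by
    intro p
    rw [← RingHom.comp_apply, ← RingHom.comp_apply]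
    congr 1
    refine Polynomial.ringHom_ext' (MvPolynomial.ringHom_ext ?_ ?_) ?_
    · simp [ev, polyMap]
    · simp [ev, polyMap, hσF]
    · simp [ev, polyMap, hσF]
  have hv' : ev p * ev q ≠ 0 := by rw [← map_mul]; exact hv
  have h3 := congrArg ev h
  simp only [map_mul, hev] at h3
  have h4 : ev (Polynomial.C (MvPolynomial.C e)) = e := by simp [ev]
  have hq0 : ev q ≠ 0 := right_ne_zero_of_mul hv'
  have hq1 : σ (ev q) ≠ 0 := (map_ne_zero σ).2 hq0
  refine ⟨ev p / ev q, ?_⟩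
  rw [h4] at h3
  rw [map_div₀]
  field_simp
  linear_combination h3

lemma exists_mul_norm_eq_one_of_eq_zpow {F : Type*} [Field F] [Infinite F] {ι : F →+* M}
    {σ : M →+* M} (hσ : ∀ x, σ (σ x) = x) (hσF : ∀ x : F, σ (ι x) = ι x)
    {e : M} (he : e ≠ 0) {ρ : Polynomial (MvPolynomial κ M)} (hρ : Prime ρ)
    (hσρ : polyMap κ σ ρ = ρ) {l : RatField M κ} {k : ℤ}
    (h : ratConst M κ e = l * ratMap κ σ l * algebraMap _ (RatField M κ) ρ ^ k) :
    ∃ m, e * (m * σ m) = 1 := by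
  have hinj := IsFractionRing.injective (Polynomial (MvPolynomial κ M)) (RatField M κ)
  have hβρ : ratMap κ σ (algebraMap _ _ ρ) = algebraMap _ _ ρ := by
    rw [ratMap_algebraMap, hσρ]
  have hρ0 : algebraMap _ (RatField M κ) ρ ≠ 0 := (map_ne_zero_iff _ hinj).2 hρ.ne_zero
  have he' : ratConst M κ e ≠ 0 := (map_ne_zero _).2 he
  have hpoly0 : ∀ {p : Polynomial (MvPolynomial κ M)}, p ≠ 0 →
      algebraMap _ (RatField M κ) p ≠ 0 ∧ algebraMap _ (RatField M κ) (polyMap κ σ p) ≠ 0 :=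
    fun hp => ⟨(map_ne_zero_iff _ hinj).2 hp,
      (map_ne_zero_iff _ hinj).2 ((map_ne_zero_iff _ (polyMap_injective κ σ)).2 hp)⟩
  obtain ⟨j, rfl | rfl⟩ := k.even_or_odd'
  · have h1 : ratConst M κ e =
        (l * algebraMap _ _ ρ ^ j) * ratMap κ σ (l * algebraMap _ _ ρ ^ j) := by
      rw [h, map_mul, map_zpow₀, hβρ, two_mul, zpow_add₀ hρ0]
      ring
    obtain ⟨q, p, hp, hqp⟩ := IsFractionRing.div_surjective (A := Polynomial (MvPolynomial κ M))
      (l * algebraMap _ _ ρ ^ j)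
    have hp0 : p ≠ 0 := nonZeroDivisors.ne_zero hp
    rw [← hqp, map_div₀, ratMap_algebraMap, ratMap_algebraMap] at h1
    have hq0 : q ≠ 0 := by
      rintro rfl
      simp [he'] at h1
    refine exists_mul_norm_eq_one hσF hp0 hq0 (hinj ?_)
    obtain ⟨h2, h3⟩ := hpoly0 hp0
    rw [div_mul_div_comm, eq_div_iff (mul_ne_zero h2 h3)] at h1
    simp only [map_mul]
    exact h1
  · exfalso
    have h1 : ratConst M κ e = (l * algebraMap _ _ ρ ^ j) * ratMap κ σ (l * algebraMap _ _ ρ ^ j) *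
        algebraMap _ _ ρ := by
      rw [h, map_mul, map_zpow₀, hβρ, two_mul, zpow_add₀ hρ0, zpow_add₀ hρ0, zpow_one]
      ring
    obtain ⟨q, p, hqp, hx⟩ := IsFractionRing.exists_reduced_fraction
      (A := Polynomial (MvPolynomial κ M)) (l * algebraMap _ _ ρ ^ j)
    obtain ⟨p, hpm⟩ := p
    obtain ⟨h2, h3⟩ := hpoly0 (nonZeroDivisors.ne_zero hpm)
    rw [← hx, IsFractionRing.mk'_eq_div, map_div₀, ratMap_algebraMap, ratMap_algebraMap,
      div_mul_div_comm, div_mul_eq_mul_div, eq_div_iff (mul_ne_zero h2 h3)] at h1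
    have h4 : Polynomial.C (MvPolynomial.C e) * (p * polyMap κ σ p) = q * polyMap κ σ q * ρ := by
      apply hinj
      simp only [map_mul]
      exact h1
    have hdvd : ∀ {x : Polynomial (MvPolynomial κ M)}, ρ ∣ x * polyMap κ σ x → ρ ∣ x := by
      intro x hx
      rcases hρ.dvd_or_dvd hx with h5 | h5
      · exact h5
      · have := map_dvd (polyMap κ σ) h5
        rwa [hσρ, polyMap_polyMap hσ] at this
    have heu : IsUnit (Polynomial.C (MvPolynomial.C e : MvPolynomial κ M)) :=
      ((isUnit_iff_ne_zero.2 he).map MvPolynomial.C).map Polynomial.C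
    have hp : ρ ∣ p := hdvd (heu.dvd_mul_left.1 ⟨_, h4.trans (mul_comm _ _)⟩)
    obtain ⟨p', hp'⟩ := hp
    have hq : ρ ∣ q := by
      refine hdvd ⟨Polynomial.C (MvPolynomial.C e) * (p' * polyMap κ σ p'), ?_⟩
      apply mul_right_cancel₀ hρ.ne_zero
      rw [← h4, hp', map_mul, hσρ]
      ring
    exact hρ.not_isUnit (hqp hq ⟨p', hp'⟩)

end Parity

section ResidualForm

/-- The constant term `b₂z₀² + [a₃,b₃](z₁,z₂) + h` of the polynomial `residualPoly`. -/
noncomputable def residualConst {A τ : Type*} [CommRing A] (b₂ a₃ b₃ : A) (h : MvPolynomial τ A) :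
    MvPolynomial (Fin 3 ⊕ τ) A :=
  MvPolynomial.C b₂ * X (.inl 0) ^ 2 + MvPolynomial.C a₃ * X (.inl 1) ^ 2 +
    X (.inl 1) * X (.inl 2) +
    MvPolynomial.C b₃ * X (.inl 2) ^ 2 + rename .inr h

/-- The form `[a₂,b₂] ⊥ [a₃,b₃] ⊥ h` as a polynomial in its first variable. -/
noncomputable def residualPoly {A τ : Type*} [CommRing A] (a₂ b₂ a₃ b₃ : A)
    (h : MvPolynomial τ A) : Polynomial (MvPolynomial (Fin 3 ⊕ τ) A) :=
  Polynomial.C (MvPolynomial.C a₂) * Polynomial.X ^ 2 + Polynomial.C (X (.inl 0)) * Polynomial.X +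
    Polynomial.C (residualConst b₂ a₃ b₃ h)

lemma map_residualPoly {A B τ : Type*} [CommRing A] [CommRing B] (f : A →+* B) (a₂ b₂ a₃ b₃ : A)
    (h : MvPolynomial τ A) :
    (residualPoly a₂ b₂ a₃ b₃ h).map (MvPolynomial.map f) =
      residualPoly (f a₂) (f b₂) (f a₃) (f b₃) (MvPolynomial.map f h) := by
  simp [residualPoly, residualConst, MvPolynomial.map_rename]

lemma prime_residualPoly {M τ : Type*} [Field M] [CharP M 2] {a₂ : M} (ha₂ : a₂ ≠ 0) (b₂ a₃ b₃ : M)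
    (h : MvPolynomial τ M) : Prime (residualPoly a₂ b₂ a₃ b₃ h) := by
  classical
  have hu : IsUnit (Polynomial.C (MvPolynomial.C a₂⁻¹ : MvPolynomial (Fin 3 ⊕ τ) M)) :=
    ((isUnit_iff_ne_zero.2 (inv_ne_zero ha₂)).map MvPolynomial.C).map Polynomial.C
  set g := Polynomial.C (MvPolynomial.C a₂⁻¹) * residualPoly a₂ b₂ a₃ b₃ h with hg
  suffices hi : Irreducible g by
    exact ((associated_isUnit_mul_left_iff hu).2 (Associated.refl _)).prime_iff.1 hi.prime
  have hgX : g = Polynomial.X ^ 2 + (Polynomial.C (MvPolynomial.C a₂⁻¹ * X (.inl 0)) * Polynomial.X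
      +
      Polynomial.C (MvPolynomial.C a₂⁻¹ * residualConst b₂ a₃ b₃ h)) := by
    have h1 : (Polynomial.C (MvPolynomial.C a₂⁻¹ : MvPolynomial (Fin 3 ⊕ τ) M)) *
        Polynomial.C (MvPolynomial.C a₂) = 1 := by
      rw [← map_mul, ← map_mul, inv_mul_cancel₀ ha₂, map_one, map_one]
    rw [hg, residualPoly]
    simp only [map_mul]
    linear_combination Polynomial.X ^ 2 * h1
  have hgm : g.Monic := by rw [hgX]; monicity!
  have hgd : g.natDegree = 2 := by rw [hgX]; compute_degree!
  rw [hgm.irreducible_iff_roots_eq_zero_of_degree_le_three (by lia) (by lia)]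
  rw [Multiset.eq_zero_iff_forall_notMem]
  intro y hy
  rw [Polynomial.mem_roots hgm.ne_zero, Polynomial.IsRoot, hg, Polynomial.eval_mul,
    Polynomial.eval_C, mul_eq_zero, or_iff_right (by simpa using ha₂)] at hy
  have h2 : (2 : MvPolynomial (Fin 3 ⊕ τ) M) = 0 := CharTwo.two_eq_zero
  have hh : pderiv (.inl 1) (rename .inr h : MvPolynomial (Fin 3 ⊕ τ) M) = 0 := by
    apply pderiv_eq_zero_of_notMem_vars
    intro hmem
    simpa using vars_rename _ _ hmem
  have h3 := congrArg (pderiv (.inl 1)) hy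
  simp [residualPoly, residualConst, hh, pderiv_X, h2, Derivation.leibniz_pow] at h3
  have h4 := congrArg (eval (Sum.elim ![0, 0, 1] 0)) h3
  simp at h4

end ResidualForm

section TernaryQuadraticExtension

variable {E : Type*} [Field E] [CharP E 2] {a b d : E}

/-- An isotropic vector of `[a,b] ⊥ ⟨1⟩` over the quadratic extension `E[ω]`, `ω² = d + ω`, spans
over `E` a binary form similar to the norm form of `E[ω]`. -/
lemma exists_polar_ne_zero_of_not_ternaryAniso (h : TernaryAniso a b)
    (hM : ¬ TernaryAniso (algebraMap E (QuadraticAlgebra E d 1) a) (algebraMap E _ b)) :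
    ∃ x₀ y₀ z₀ x₁ y₁ z₁ e : E, e ≠ 0 ∧ e = x₀ * y₁ + x₁ * y₀ ∧
      a * x₁ ^ 2 + x₁ * y₁ + b * y₁ ^ 2 + z₁ ^ 2 = e ∧
      a * x₀ ^ 2 + x₀ * y₀ + b * y₀ ^ 2 + z₀ ^ 2 = d * e := by
  have h2 : (2 : E) = 0 := CharTwo.two_eq_zero
  simp only [TernaryAniso, not_forall] at hM
  obtain ⟨x, y, z, h0, hne⟩ := hM
  have hre := congrArg QuadraticAlgebra.re h0
  have him := congrArg QuadraticAlgebra.im h0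
  simp [pow_two] at hre him
  have h1 : a * x.im ^ 2 + x.im * y.im + b * y.im ^ 2 + z.im ^ 2 = x.re * y.im + x.im * y.re := by
    linear_combination him - (a * x.re * x.im + b * y.re * y.im + z.re * z.im + x.re * y.im +
      x.im * y.re) * h2
  have h3 : a * x.re ^ 2 + x.re * y.re + b * y.re ^ 2 + z.re ^ 2 =
      d * (x.re * y.im + x.im * y.re) := by
    linear_combination hre + d * h1 - d * (a * x.im ^ 2 + x.im * y.im + b * y.im ^ 2 +
      z.im ^ 2) * h2
  refine ⟨x.re, y.re, z.re, x.im, y.im, z.im, _, fun h4 => hne ?_, rfl, h1, h3⟩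
  rw [h4] at h1 h3
  obtain ⟨hx, hy, hz⟩ := h _ _ _ h1
  obtain ⟨hx', hy', hz'⟩ := h _ _ _ (h3.trans (mul_zero d))
  exact ⟨QuadraticAlgebra.ext hx' hx, QuadraticAlgebra.ext hy' hy, QuadraticAlgebra.ext hz' hz⟩

lemma mul_norm_ne_one_of_ternaryAniso (h : TernaryAniso a b) {x₀ y₀ z₀ x₁ y₁ z₁ e : E} (he : e ≠ 0)
    (hb : e = x₀ * y₁ + x₁ * y₀) (h₁ : a * x₁ ^ 2 + x₁ * y₁ + b * y₁ ^ 2 + z₁ ^ 2 = e)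
    (h₀ : a * x₀ ^ 2 + x₀ * y₀ + b * y₀ ^ 2 + z₀ ^ 2 = d * e) (m : QuadraticAlgebra E d 1) :
    algebraMap E _ e * (m * star m) ≠ 1 := by
  intro hm
  have h2 : (2 : E) = 0 := CharTwo.two_eq_zero
  have hre := congrArg QuadraticAlgebra.re hm
  simp [QuadraticAlgebra.re_one] at hre
  obtain ⟨hx, hy, hz⟩ := h (m.im * x₀ + m.re * x₁) (m.im * y₀ + m.re * y₁)
    (m.im * z₀ + m.re * z₁ + 1) (by
      linear_combination m.im ^ 2 * h₀ + m.re ^ 2 * h₁ - m.im * m.re * hb + hre + (1 + m.im * z₀ +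
        m.re * z₁ + e * m.im ^ 2 * d + m.im * m.re * (a * x₀ * x₁ + b * y₀ * y₁ + z₀ * z₁)) * h2)
  have him : m.im = 0 := by
    refine (mul_eq_zero.1 (?_ : m.im * e = 0)).resolve_right he
    linear_combination m.im * hb + y₁ * hx + x₁ * hy - m.re * x₁ * y₁ * h2
  have hr : m.re = 0 := by
    refine (mul_eq_zero.1 (?_ : m.re * e = 0)).resolve_right he
    linear_combination m.re * hb + y₀ * hx + x₀ * hy - m.im * x₀ * y₀ * h2
  simp [him, hr] at hz

end TernaryQuadraticExtension

section GenericPoint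

variable {F : Type*} [Field F] {τ : Type*}

/-- The map `F[κ][X] → M(κ, X)` induced by a field extension. -/
noncomputable def ratMapOfExt {M : Type*} [Field M] (κ : Type*) (ι : F →+* M) :
    Polynomial (MvPolynomial κ F) →+* RatField M κ :=
  (algebraMap _ _).comp (Polynomial.mapRingHom (MvPolynomial.map ι))

lemma ratMapOfExt_C_C {M : Type*} [Field M] (κ : Type*) (ι : F →+* M) (x : F) :
    ratMapOfExt κ ι (Polynomial.C (MvPolynomial.C x)) = ratConst M κ (ι x) := by
  simp [ratMapOfExt, ratConst]

lemma ratMapOfExt_linearIndep {M : Type*} [Field M] (κ : Type*) (ι : F →+* M) {s t : M}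
    (hst : ∀ x y z, ι x + s * ι y + t * ι z = 0 → x = 0 ∧ y = 0 ∧ z = 0)
    (x y z : Polynomial (MvPolynomial κ F))
    (h : ratMapOfExt κ ι x + ratConst M κ s * ratMapOfExt κ ι y +
      ratConst M κ t * ratMapOfExt κ ι z = 0) : x = 0 ∧ y = 0 ∧ z = 0 := by
  simp only [ratMapOfExt, ratConst, RingHom.comp_apply, ← map_mul, ← map_add] at h
  rw [map_eq_zero_iff _ (IsFractionRing.injective _ _)] at h
  have h1 : ∀ n m, (x.coeff n).coeff m = 0 ∧ (y.coeff n).coeff m = 0 ∧ (z.coeff n).coeff m = 0 := by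
    intro n m
    apply hst
    simpa [MvPolynomial.coeff_map, MvPolynomial.coeff_C_mul] using
      congrArg (fun p => (p.coeff n).coeff m) h
  exact ⟨Polynomial.ext fun n => MvPolynomial.ext _ _ fun m => (h1 n m).1,
    Polynomial.ext fun n => MvPolynomial.ext _ _ fun m => (h1 n m).2.1,
    Polynomial.ext fun n => MvPolynomial.ext _ _ fun m => (h1 n m).2.2⟩

end GenericPoint

section Core

open LaurentPolynomial

variable {F : Type*} [Field F]

/-- The quadric `[a₁,b₁] ⊥ [a₂,b₂] ⊥ [a₃,b₃] ⊥ h` as a polynomial in its first three variables. -/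
noncomputable def quadricPoly {τ : Type*} (a₁ b₁ a₂ b₂ a₃ b₃ : F) (h : MvPolynomial τ F) :
    Polynomial (Polynomial (Polynomial (MvPolynomial (Fin 3 ⊕ τ) F))) :=
  quadYT (Polynomial.C (MvPolynomial.C a₁)) (Polynomial.C (MvPolynomial.C b₁))
    (residualPoly a₂ b₂ a₃ b₃ h)

/-- Constants of the iterated polynomial ring. -/
noncomputable def iterC (κ F : Type*) [Field F] :
    F →+* Polynomial (Polynomial (Polynomial (MvPolynomial κ F))) :=
  Polynomial.C.comp (Polynomial.C.comp (Polynomial.C.comp MvPolynomial.C))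

lemma exists_generic_zero {M : Type*} [Field M] [CharP M 2] (ι : F →+* M) {τ : Type*}
    {a b c₂ c₃ a₁ b₁ a₂ b₂ a₃ b₃ : F} (ha₁ : a₁ ≠ 0) (ha₂ : a₂ ≠ 0) (h : MvPolynomial τ F)
    {s t ω : M} (hs : s ^ 2 = ι c₂) (ht : t ^ 2 = ι c₃)
    (hst : ∀ x y z, ι x + s * ι y + t * ι z = 0 → x = 0 ∧ y = 0 ∧ z = 0)
    (hω : ω ^ 2 + ω = ι a₁ * ι b₁)
    (p : Fin 5 → Polynomial (Polynomial (Polynomial (MvPolynomial (Fin 3 ⊕ τ) F))))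
    (hp : quadricPoly a₁ b₁ a₂ b₂ a₃ b₃ h ∣ iterC _ F a * p 0 ^ 2 + p 0 * p 1 +
      iterC _ F b * p 1 ^ 2 +
      p 2 ^ 2 + iterC _ F c₂ * p 3 ^ 2 + iterC _ F c₃ * p 4 ^ 2) :
    ∃ (ρ : Polynomial (MvPolynomial (Fin 3 ⊕ τ) M)) (ρ' : (RatField M (Fin 3 ⊕ τ))ˣ)
      (x y z : (RatField M (Fin 3 ⊕ τ))[T;T⁻¹]),
      Prime ρ ∧ (ρ' : RatField M (Fin 3 ⊕ τ)) = algebraMap _ _ ρ ∧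
      LaurentPolynomial.C (ratConst M _ (ι a)) * x ^ 2 + x * y +
        LaurentPolynomial.C (ratConst M _ (ι b)) * y ^ 2 + z ^ 2 = 0 ∧
      (x = 0 ∧ y = 0 ∧ z = 0 → ∀ i, quadricPoly a₁ b₁ a₂ b₂ a₃ b₃ h ∣ p i) ∧
      ∀ σ : M →+* M, (∀ x, σ (ι x) = ι x) → σ s = s → σ t = t → σ ω = ω + 1 →
        polyMap _ σ ρ = ρ ∧ laurentSwap (ratMap _ σ) ρ' x = x ∧
        laurentSwap (ratMap _ σ) ρ' y = y ∧ laurentSwap (ratMap _ σ) ρ' z = z := by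
  set f := ratMapOfExt (Fin 3 ⊕ τ) ι with hf
  have hιa₁ : ι a₁ ≠ 0 := (map_ne_zero ι).2 ha₁
  have hιa₂ : ι a₂ ≠ 0 := (map_ne_zero ι).2 ha₂
  have : CharP (RatField M (Fin 3 ⊕ τ)) 2 := charP_of_injective_ringHom (ratConst M (Fin 3 ⊕
      τ)).injective 2
  have hu : IsUnit (Polynomial.C (MvPolynomial.C (ι a₁) : MvPolynomial (Fin 3 ⊕ τ) M)) :=
    ((isUnit_iff_ne_zero.2 hιa₁).map MvPolynomial.C).map Polynomial.C
  have hu' : IsUnit (Polynomial.C (MvPolynomial.C a₁ : MvPolynomial (Fin 3 ⊕ τ) F)) :=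
    ((isUnit_iff_ne_zero.2 ha₁).map MvPolynomial.C).map Polynomial.C
  obtain ⟨ρ, hρ⟩ : ∃ ρ, ρ = Polynomial.C (MvPolynomial.C (ι a₁) : MvPolynomial (Fin 3 ⊕ τ) M) *
      (residualPoly (ι a₂) (ι b₂) (ι a₃) (ι b₃) (MvPolynomial.map ι h)) := ⟨_, rfl⟩
  have hρp : Prime ρ := by
    rw [hρ]
    exact ((associated_isUnit_mul_left_iff hu).2 (Associated.refl _)).prime_iff.2
      (prime_residualPoly hιa₂ _ _ _ _)
  obtain ⟨ρ', hρ'⟩ : ∃ ρ' : (RatField M (Fin 3 ⊕ τ))ˣ, (ρ' : RatField M (Fin 3 ⊕ τ)) =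
      algebraMap _ _ ρ :=
    ⟨Units.mk0 _ ((map_ne_zero_iff _ (IsFractionRing.injective _ _)).2 hρp.ne_zero), rfl⟩
  set A := Polynomial.C (MvPolynomial.C a₁ : MvPolynomial (Fin 3 ⊕ τ) F)
  set B := Polynomial.C (MvPolynomial.C b₁ : MvPolynomial (Fin 3 ⊕ τ) F)
  have hfA : f A = ratConst M (Fin 3 ⊕ τ) (ι a₁) := ratMapOfExt_C_C _ _ _
  have hfB : f B = ratConst M (Fin 3 ⊕ τ) (ι b₁) := ratMapOfExt_C_C _ _ _
  have hω' : ratConst M (Fin 3 ⊕ τ) ω ^ 2 + ratConst M (Fin 3 ⊕ τ) ω = f A * f B := by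
    rw [hfA, hfB, ← map_mul, ← hω, map_add, map_pow]
  have hρf : (ρ' : RatField M (Fin 3 ⊕ τ)) = f A * f (residualPoly a₂ b₂ a₃ b₃ h) := by
    rw [hρ', hρ, hfA, hf, ratMapOfExt, RingHom.comp_apply, Polynomial.coe_mapRingHom,
      map_residualPoly, map_mul]
    rfl
  have hdvd := fun p q r => quadYT_dvd_of_evalYT_add_eq_zero f hu' hω' hρf
    (ratMapOfExt_linearIndep (Fin 3 ⊕ τ) ι hst) (p := p) (q := q) (r := r)
  set ev := evalYT f ρ' (f A) (ratConst M (Fin 3 ⊕ τ) ω) with hev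
  have hevC : ∀ x, ev (iterC (Fin 3 ⊕ τ) F x) = LaurentPolynomial.C (ratConst M (Fin 3 ⊕ τ) (ι x))
      := by
    intro x
    simp [hev, evalYT, iterC, hf, ratMapOfExt_C_C]
  have hevq : ev (quadricPoly a₁ b₁ a₂ b₂ a₃ b₃ h) = 0 :=
    evalYT_quadYT f (hu'.map f).ne_zero hω' hρf
  refine ⟨ρ, ρ', ev (p 0), ev (p 1), ev (p 2) + LaurentPolynomial.C (ratConst M (Fin 3 ⊕ τ) s) * ev
    (p 3) +
    LaurentPolynomial.C (ratConst M (Fin 3 ⊕ τ) t) * ev (p 4), hρp, hρ', ?_, ?_, ?_⟩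
  · obtain ⟨g, hg⟩ := hp
    have h1 := congrArg ev hg
    simp only [map_add, map_mul, map_pow, hevC, hevq, zero_mul, ← hs, ← ht] at h1
    have h2 : (2 : (RatField M (Fin 3 ⊕ τ))[T;T⁻¹]) = 0 := two_laurent_eq_zero
    generalize LaurentPolynomial.C (ratConst M (Fin 3 ⊕ τ) s) = s' at *
    generalize LaurentPolynomial.C (ratConst M (Fin 3 ⊕ τ) t) = t' at *
    linear_combination h1 + (ev (p 2) * s' * ev (p 3) + ev (p 2) * t' * ev (p 4) +
      s' * ev (p 3) * t' * ev (p 4)) * h2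
  · rintro ⟨h0, h1, h2⟩ i
    have h3 := hdvd _ _ _ h2
    have h0' := (hdvd (p 0) 0 0 (by simp [h0])).1
    have h1' := (hdvd (p 1) 0 0 (by simp [h1])).1
    fin_cases i
    exacts [h0', h1', h3.1, h3.2.1, h3.2.2]
  · intro σ hσ hσs hσt hσω
    have hconst : ∀ m : M, ratMap (Fin 3 ⊕ τ) σ (ratConst M (Fin 3 ⊕ τ) m) =
        ratConst M (Fin 3 ⊕ τ) (σ m) := by
      intro m
      simp only [ratConst, RingHom.comp_apply, ratMap_algebraMap, polyMap_C_C]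
    have hσι : σ.comp ι = ι := RingHom.ext hσ
    have hσf : ∀ x, ratMap (Fin 3 ⊕ τ) σ (f x) = f x := by
      intro x
      simp only [hf, ratMapOfExt, RingHom.comp_apply, ratMap_algebraMap, polyMap,
        Polynomial.coe_mapRingHom, Polynomial.map_map]
      congr 3
      refine RingHom.ext fun x => ?_
      simp [MvPolynomial.map_map, hσι]
    have hσρ' : ratMap (Fin 3 ⊕ τ) σ ρ' = ρ' := by rw [hρf, map_mul, hσf, hσf]
    have hσev : ∀ x, laurentSwap (ratMap (Fin 3 ⊕ τ) σ) ρ' (ev x) = ev x :=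
      laurentSwap_evalYT f hσρ' (hσf A) (by rw [hconst, hσω, map_add, map_one]) hσf
    refine ⟨?_, hσev _, hσev _, ?_⟩
    · apply IsFractionRing.injective (Polynomial (MvPolynomial (Fin 3 ⊕ τ) M)) (RatField M (Fin 3 ⊕
      τ))
      rw [← ratMap_algebraMap, ← hρ', hσρ']
    · simp only [map_add, map_mul, hσev, laurentSwap_C, hconst, hσs, hσt]

end Core

section QuadricCore

open LaurentPolynomial

variable {F : Type*} [Field F]

/-- The norm identity attached to an isotropic vector of `[a,b] ⊥ ⟨1⟩` whose first two entries
are decomposed along a basis of the plane. -/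
lemma norm_identity {R : Type*} [CommRing R] (h2 : (2 : R) = 0)
    {a b d ω e e' x₀ y₀ z₀ x₁ y₁ z₁ x y z : R}
    (hω : ω ^ 2 = ω + d) (hee : e' * e = 1) (hb : e = x₀ * y₁ + x₁ * y₀)
    (h₁ : a * x₁ ^ 2 + x₁ * y₁ + b * y₁ ^ 2 + z₁ ^ 2 = e)
    (h₀ : a * x₀ ^ 2 + x₀ * y₀ + b * y₀ ^ 2 + z₀ ^ 2 = d * e)
    (h : a * x ^ 2 + x * y + b * y ^ 2 + z ^ 2 = 0) {α β : R}
    (hα : α = (x * y₁ + y * x₁) * e') (hβ : β = (x * y₀ + y * x₀) * e') :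
    x = α * x₀ + β * x₁ ∧ y = α * y₀ + β * y₁ ∧
      e * ((β + α * ω) * (β + α * (ω + 1))) = (z + α * z₀ + β * z₁) ^ 2 := by
  have hx : x = α * x₀ + β * x₁ := by
    rw [hα, hβ]
    linear_combination -x * hee + e' * x * hb - e' * y * x₀ * x₁ * h2
  have hy : y = α * y₀ + β * y₁ := by
    rw [hα, hβ]
    linear_combination -y * hee + e' * y * hb - e' * x * y₀ * y₁ * h2
  refine ⟨hx, hy, ?_⟩
  rw [hx, hy] at h
  linear_combination e * α ^ 2 * hω - β ^ 2 * h₁ - α ^ 2 * h₀ + α * β * hb + h +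
    (e * α * β * ω + e * α ^ 2 * ω - a * α * β * x₀ * x₁ - b * α * β * y₀ * y₁ - z ^ 2 -
      z * α * z₀ - z * β * z₁ - α * β * z₀ * z₁) * h2

theorem quadricPoly_dvd_of_ternaryAniso [Infinite F] {E : Type*} [Field E] [CharP E 2] (ι : F →+* E)
    {τ : Type*} {a b c₂ c₃ a₁ b₁ a₂ b₂ a₃ b₃ : F} (ha₁ : a₁ ≠ 0) (ha₂ : a₂ ≠ 0)
    (h : MvPolynomial τ F) {s t : E} (hs : s ^ 2 = ι c₂) (ht : t ^ 2 = ι c₃)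
    (hst : ∀ x y z, ι x + s * ι y + t * ι z = 0 → x = 0 ∧ y = 0 ∧ z = 0)
    (hE : TernaryAniso (ι a) (ι b))
    (p : Fin 5 → Polynomial (Polynomial (Polynomial (MvPolynomial (Fin 3 ⊕ τ) F))))
    (hp : quadricPoly a₁ b₁ a₂ b₂ a₃ b₃ h ∣ iterC _ F a * p 0 ^ 2 + p 0 * p 1 +
      iterC _ F b * p 1 ^ 2 + p 2 ^ 2 + iterC _ F c₂ * p 3 ^ 2 +
        iterC _ F c₃ * p 4 ^ 2) (i : Fin 5) :
    quadricPoly a₁ b₁ a₂ b₂ a₃ b₃ h ∣ p i := by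
  have : Infinite E := .of_injective _ ι.injective
  by_cases hω : ∃ ω : E, ω ^ 2 + ω = ι a₁ * ι b₁
  · obtain ⟨ω, hω⟩ := hω
    obtain ⟨ρ, ρ', x, y, z, -, -, hxyz, h0, -⟩ :=
      exists_generic_zero ι ha₁ ha₂ h hs ht hst hω p hp
    exact h0 (hE.laurent _ x y z hxyz) i
  push Not at hω
  obtain ⟨d, hd⟩ : ∃ d, d = ι a₁ * ι b₁ := ⟨_, rfl⟩
  rw [← hd] at hω
  have hfact : Fact (∀ r : E, r ^ 2 ≠ d + 1 * r) := ⟨fun r hr => hω r (by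
    rw [hr]
    linear_combination r * CharTwo.two_eq_zero (R := E))⟩
  let j : E →+* QuadraticAlgebra E d 1 := algebraMap E (QuadraticAlgebra E d 1)
  have : CharP (QuadraticAlgebra E d 1) 2 := charP_of_injective_ringHom j.injective 2
  have : Infinite (QuadraticAlgebra E d 1) := .of_injective _ j.injective
  have h2M : (2 : QuadraticAlgebra E d 1) = 0 := CharTwo.two_eq_zero
  let ω : QuadraticAlgebra E d 1 := QuadraticAlgebra.omega
  have hω2 : ω ^ 2 + ω = j d := by
    ext <;> simp [ω, j, pow_two, CharTwo.add_self_eq_zero]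
  let σ : QuadraticAlgebra E d 1 →+* QuadraticAlgebra E d 1 := starRingEnd _
  have hσj : ∀ x, σ (j x) = j x := fun x => by ext <;> simp [σ, j, starRingEnd_apply]
  have hσω : σ ω = ω + 1 := by
    ext <;> simp [σ, ω, starRingEnd_apply, CharTwo.neg_eq, QuadraticAlgebra.re_one,
      QuadraticAlgebra.im_one]
  have hσσ : ∀ x, σ (σ x) = x := star_star
  obtain ⟨ρ, ρ', x, y, z, hρ, hρρ', hxyz, h0, hfix⟩ :=
    exists_generic_zero (j.comp ι) (s := j s) (t := j t) (ω := ω) ha₁ ha₂ h (by simp [← map_pow,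
      hs])
      (by simp [← map_pow, ht]) (fun x y z h => hst x y z (j.injective (by simpa using h)))
      (hω2.trans ((congrArg j hd).trans (map_mul j _ _))) p hp
  refine h0 ?_ i
  obtain ⟨hσρ, hσx, hσy, hσz⟩ := hfix σ (fun x => hσj _) (hσj s) (hσj t) hσω
  by_contra hne
  obtain ⟨x₀, y₀, z₀, x₁, y₁, z₁, e, he, hb, h₁, h₀⟩ :=
    exists_polar_ne_zero_of_not_ternaryAniso (d := d) hE fun hM => hne (hM.laurent _ x y z hxyz)
  let τ' := laurentSwap (ratMap (Fin 3 ⊕ τ) σ) ρ'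
  let J : E →+* (RatField (QuadraticAlgebra E d 1) (Fin 3 ⊕ τ))[T;T⁻¹] :=
    (LaurentPolynomial.C.comp (ratConst _ (Fin 3 ⊕ τ))).comp j
  have hβ : ∀ f, ratMap (Fin 3 ⊕ τ) σ (ratMap (Fin 3 ⊕ τ) σ f) = f := ratMap_ratMap hσσ
  have hβρ : ratMap (Fin 3 ⊕ τ) σ ρ' = ρ' := by
    rw [hρρ', ratMap_algebraMap, hσρ]
  have hβc : ∀ m, ratMap (Fin 3 ⊕ τ) σ (ratConst _ _ m) = ratConst _ _ (σ m) := fun m => by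
    simp [ratConst, ratMap_algebraMap, polyMap_C_C]
  have hτ' : ∀ f, τ' (τ' f) = f := laurentSwap_involutive hβ hβρ
  have hτJ : ∀ m, τ' (J m) = J m := fun m => by
    simp [τ', J, laurentSwap_C, hβc, hσj]
  let w : (RatField (QuadraticAlgebra E d 1) (Fin 3 ⊕ τ))[T;T⁻¹] :=
    LaurentPolynomial.C (ratConst _ (Fin 3 ⊕ τ) ω)
  have hτw : τ' w = w + 1 := by
    simp [τ', w, laurentSwap_C, hβc, hσω]
  have h2L : (2 : (RatField (QuadraticAlgebra E d 1) (Fin 3 ⊕ τ))[T;T⁻¹]) = 0 := by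
    rw [← map_ofNat J 2, CharTwo.two_eq_zero, map_zero]
  have hw : w ^ 2 = w + J d := by
    have : J d = w ^ 2 + w := by
      simp only [J, w, RingHom.comp_apply, ← hω2, map_add, map_pow]
    linear_combination -this - w * h2L
  have hee : J e⁻¹ * J e = 1 := by rw [← map_mul, inv_mul_cancel₀ he, map_one]
  have hJ : ∀ {u v}, u = v → J u = J v := fun h => congrArg J h
  obtain ⟨α, hα⟩ : ∃ α, α = (x * J y₁ + y * J x₁) * J e⁻¹ := ⟨_, rfl⟩
  obtain ⟨β, hβ⟩ : ∃ β, β = (x * J y₀ + y * J x₀) * J e⁻¹ := ⟨_, rfl⟩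
  replace hxyz : J (ι a) * x ^ 2 + x * y + J (ι b) * y ^ 2 + z ^ 2 = 0 := hxyz
  obtain ⟨hx, hy, hN⟩ := norm_identity h2L hw hee (by simpa using hJ hb) (by simpa using hJ h₁)
    (by simpa using hJ h₀) hxyz hα hβ
  have hτα : τ' α = α := by simp only [hα, map_add, map_mul, hτJ, τ', hσx, hσy]
  have hτβ : τ' β = β := by simp only [hβ, map_add, map_mul, hτJ, τ', hσx, hσy]
  obtain ⟨P, hP⟩ : ∃ P, P = z + α * J z₀ + β * J z₁ := ⟨_, rfl⟩
  have hτP : τ' P = P := by simp only [hP, map_add, map_mul, hτJ, hτα, hτβ]; rw [hσz]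
  obtain ⟨A, hA⟩ : ∃ A, A = β + α * w := ⟨_, rfl⟩
  have hτA : τ' A = β + α * (w + 1) := by simp only [hA, map_add, map_mul, hτα, hτβ, hτw]
  rw [← hA, ← hτA, ← hP] at hN
  have hJe : IsUnit (J e) := (isUnit_iff_ne_zero.2 he).map J
  have hP0 : P ≠ 0 := by
    intro hP0
    have hA0 : A = 0 := by
      rw [hP0, zero_pow two_ne_zero, hJe.mul_right_eq_zero, mul_eq_zero] at hN
      exact hN.elim id fun h => by rw [← hτ' A, h, map_zero]
    have hα0 : α = 0 := by
      rw [hA0, map_zero] at hτA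
      linear_combination hA - hA0 - hτA
    have hβ0 : β = 0 := by simpa [hα0, hA0] using hA.symm
    refine hne ?_
    refine ⟨by simp [hx, hα0, hβ0], by simp [hy, hα0, hβ0], ?_⟩
    simpa [hα0, hβ0, hP0] using hP.symm
  obtain ⟨u, hu, hJu⟩ := exists_isUnit_eq_mul_of_mul_norm_eq_norm τ' hτ' hJe
    (LaurentPolynomial.exists_isCoprime A hP0) hP0 (by rw [hN, hτP, pow_two])
  obtain ⟨l, k, hl, rfl⟩ := LaurentPolynomial.exists_eq_C_mul_T_of_isUnit hu
  have hle : ratConst _ (Fin 3 ⊕ τ) (j e) =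
      l * ratMap (Fin 3 ⊕ τ) σ l * algebraMap _ _ ρ ^ k := by
    apply (LaurentPolynomial.C (R := RatField (QuadraticAlgebra E d 1) (Fin 3 ⊕ τ))).injective
    rw [show LaurentPolynomial.C (ratConst _ (Fin 3 ⊕ τ) (j e)) = J e from rfl, hJu]
    simp only [τ', map_mul, laurentSwap_C, laurentSwap_T, Units.val_zpow_eq_zpow_val, hρρ']
    have : (T k : (RatField (QuadraticAlgebra E d 1) (Fin 3 ⊕ τ))[T;T⁻¹]) * T (-k) = 1 := by
      rw [← T_add, add_neg_cancel, T_zero]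
    linear_combination (LaurentPolynomial.C l * LaurentPolynomial.C (ratMap (Fin 3 ⊕ τ) σ l) *
      LaurentPolynomial.C (algebraMap _ _ ρ ^ k)) * this
  obtain ⟨m, hm⟩ := exists_mul_norm_eq_one_of_eq_zpow (ι := j.comp ι) hσσ (fun x => hσj _)
    ((map_ne_zero j).2 he) hρ hσρ hle
  exact mul_norm_ne_one_of_ternaryAniso hE he hb h₁ h₀ m hm

end QuadricCore

section InseparableExtension

variable {F : Type} [Field F]

lemma QuadraticAlgebra.sq_eq_algebraMap {R : Type*} [CommRing R] (h2 : (2 : R) = 0) {a : R}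
    (z : QuadraticAlgebra R a 0) :
    z ^ 2 = algebraMap R (QuadraticAlgebra R a 0) (z.re ^ 2 + a * z.im ^ 2) := by
  rw [pow_two, QuadraticAlgebra.algebraMap_eq]
  ext
  · simp
    ring
  · simp
    linear_combination z.re * z.im * h2

/-- Adjoining the square roots of `c₂` and `c₃` when `⟨1, c₂, c₃⟩` is anisotropic. -/
lemma exists_sqrt_extension [CharP F 2] {c₂ c₃ : F}
    (hc : ∀ x y z, x ^ 2 + c₂ * y ^ 2 + c₃ * z ^ 2 = 0 → x = 0 ∧ y = 0 ∧ z = 0) :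
    ∃ (E : Type) (_ : Field E) (_ : CharP E 2) (ι : F →+* E) (s t : E), s ^ 2 = ι c₂ ∧
      t ^ 2 = ι c₃ ∧ (∀ x y z, ι x + s * ι y + t * ι z = 0 → x = 0 ∧ y = 0 ∧ z = 0) ∧
      ∀ z : E, ∃ n₀ n₁ n₂ n₃ : F,
        z ^ 2 = ι (n₀ ^ 2 + c₂ * n₁ ^ 2 + c₃ * n₂ ^ 2 + c₂ * c₃ * n₃ ^ 2) := by
  have h2 : (2 : F) = 0 := CharTwo.two_eq_zero
  have hf₂ : Fact (∀ r : F, r ^ 2 ≠ c₂ + 0 * r) := ⟨fun r hr => by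
    simpa using (hc r 1 0 (by linear_combination hr + c₂ * h2)).2.1⟩
  let E₁ := QuadraticAlgebra F c₂ 0
  let i₁ : F →+* E₁ := algebraMap F E₁
  have : CharP E₁ 2 := charP_of_injective_ringHom i₁.injective 2
  have hsq₁ : ∀ z : E₁, z ^ 2 = i₁ (z.re ^ 2 + c₂ * z.im ^ 2) :=
      QuadraticAlgebra.sq_eq_algebraMap h2
  have hf₃ : Fact (∀ r : E₁, r ^ 2 ≠ i₁ c₃ + 0 * r) := ⟨fun r hr => by
    rw [zero_mul, add_zero, hsq₁] at hr
    have := i₁.injective hr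
    simpa using (hc r.re r.im 1 (by linear_combination this + c₃ * h2)).2.2⟩
  let E := QuadraticAlgebra E₁ (i₁ c₃) 0
  let i₂ : E₁ →+* E := algebraMap E₁ E
  have : CharP E 2 := charP_of_injective_ringHom i₂.injective 2
  have h2E : (2 : E₁) = 0 := CharTwo.two_eq_zero
  have hsq₂ : ∀ z : E, z ^ 2 = i₂ (z.re ^ 2 + i₁ c₃ * z.im ^ 2) :=
    QuadraticAlgebra.sq_eq_algebraMap h2E
  let s : E := i₂ (QuadraticAlgebra.omega : E₁)
  let t : E := (QuadraticAlgebra.omega : E)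
  have hs : s ^ 2 = (i₂.comp i₁) c₂ := by
    simp only [s, ← map_pow, RingHom.comp_apply, hsq₁]
    simp
  have ht : t ^ 2 = (i₂.comp i₁) c₃ := by
    simp only [t, RingHom.comp_apply, hsq₂]
    simp
  refine ⟨E, inferInstance, inferInstance, i₂.comp i₁, s, t, hs, ht, fun x y z h => ?_,
    fun z => ⟨z.re.re, z.re.im, z.im.re, z.im.im, ?_⟩⟩
  · apply hc
    apply (i₂.comp i₁).injective
    simp only [map_add, map_mul, map_pow, ← hs, ← ht, map_zero]
    have h2' : (2 : E) = 0 := CharTwo.two_eq_zero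
    generalize (i₂.comp i₁) x = x at *
    generalize (i₂.comp i₁) y = y at *
    generalize (i₂.comp i₁) z = z at *
    linear_combination (x + s * y + t * z) * h - (x * s * y + x * t * z + s * y * t * z) * h2'
  · rw [hsq₂, hsq₁, hsq₁, ← map_mul, ← map_add, RingHom.comp_apply]
    congr 2
    ring

lemma ternaryAniso_of_square_values {E : Type*} [Field E] [CharP E 2] {ι : F →+* E} {a b : F}
    {Q : F → Prop} (hE : ∀ z : E, ∃ n, Q n ∧ z ^ 2 = ι n)
    (hQ : ∀ x y, Q (a * x ^ 2 + x * y + b * y ^ 2) → x = 0 ∧ y = 0) :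
    TernaryAniso (ι a) (ι b) := by
  intro x y z h
  have h2 : (2 : E) = 0 := CharTwo.two_eq_zero
  have hx : x = 0 := by
    obtain ⟨u, -, hu⟩ := hE x
    obtain ⟨v, -, hv⟩ := hE y
    obtain ⟨w, -, hw⟩ := hE z
    obtain ⟨n, hn, hxz⟩ := hE (x * z)
    have hxy : x * y = ι (a * u + b * v + w) := by
      simp only [map_add, map_mul, ← hu, ← hv, ← hw]
      linear_combination -h + x * y * h2
    have : a * u ^ 2 + u * (a * u + b * v + w) + b * (a * u + b * v + w) ^ 2 = n := by
      apply ι.injective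
      rw [← hxz, map_add, map_add, map_mul, map_mul, map_mul, map_pow, map_pow, ← hxy, ← hu]
      linear_combination x ^ 2 * h - x ^ 2 * z ^ 2 * h2
    obtain ⟨hu0, -⟩ := hQ u _ (this ▸ hn)
    simpa [hu0] using hu
  subst hx
  by_cases hy : y = 0
  · subst hy
    exact ⟨rfl, rfl, by simpa using h⟩
  · obtain ⟨n, hn, hz⟩ := hE (z / y)
    have : b = n := by
      apply ι.injective
      rw [← hz, div_pow, eq_div_iff (pow_ne_zero 2 hy)]
      linear_combination h - z ^ 2 * h2
    have := (hQ 0 1 (by simpa [this] using hn)).2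
    exact absurd this one_ne_zero

end InseparableExtension

section PfisterNeighbour

variable {F : Type} [Field F]

lemma binQF_apply (a b : F) (v : Fin 2 → F) :
    binQF a b v = a * v 0 ^ 2 + v 0 * v 1 + b * v 1 ^ 2 := by
  simp [binQF, Matrix.toQuadraticMap', Matrix.toQuadraticForm',
    LinearMap.BilinMap.toQuadraticMap_apply, Matrix.toLinearMap₂'_apply, Fin.sum_univ_two]
  ring

lemma pfisterQF_two_apply (a : Fin 2 → F) (d : F) (w : Finset (Fin 2) → Fin 2 → F) :
    pfisterQF 2 a d w = binQF 1 d (w ∅) + a 0 * binQF 1 d (w {0}) + a 1 * binQF 1 d (w {1}) +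
      a 0 * a 1 * binQF 1 d (w {0, 1}) := by
  have : (Finset.univ : Finset (Finset (Fin 2))) = {∅, {0}, {1}, {0, 1}} := by decide
  rw [pfisterQF, QuadraticMap.pi_apply, this]
  rw [Finset.sum_insert (by decide), Finset.sum_insert (by decide), Finset.sum_insert (by decide),
    Finset.sum_singleton]
  simp
  ring

lemma isPfisterNeighbour_of_represents [CharP F 2] {φ : QuadraticForm F (Fin 5 → F)}
    (hφ : φ.Anisotropic)
    {l a b c₂ c₃ : F} (hl : l ≠ 0) (g : (Fin 5 → F) ≃ₗ[F] (Fin 5 → F))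
    (hg : ∀ v, φ v = l * (a * g v 0 ^ 2 + g v 0 * g v 1 + b * g v 1 ^ 2 + g v 2 ^ 2 +
      c₂ * g v 3 ^ 2 + c₃ * g v 4 ^ 2))
    {x y n₀ n₁ n₂ n₃ : F} (hxy : ¬ (x = 0 ∧ y = 0))
    (h : a * x ^ 2 + x * y + b * y ^ 2 = n₀ ^ 2 + c₂ * n₁ ^ 2 + c₃ * n₂ ^ 2 + c₂ * c₃ * n₃ ^ 2) :
    IsPfisterNeighbour φ := by
  have h2 : (2 : F) = 0 := CharTwo.two_eq_zero
  have haniso : ∀ w : Fin 5 → F, a * w 0 ^ 2 + w 0 * w 1 + b * w 1 ^ 2 + w 2 ^ 2 +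
      c₂ * w 3 ^ 2 + c₃ * w 4 ^ 2 = 0 → w = 0 := fun w hw => by
    have := hφ (g.symm w) (by rw [hg]; simp [hw])
    simpa using this
  have hc₂ : c₂ ≠ 0 := fun h => by simpa using congrFun (haniso ![0, 0, 0, 1, 0] (by simp [h])) 3
  have hc₃ : c₃ ≠ 0 := fun h => by simpa using congrFun (haniso ![0, 0, 0, 0, 1] (by simp [h])) 4
  have hn₃ : n₃ ≠ 0 := by
    rintro rfl
    have := haniso ![x, y, n₀, n₁, n₂] (by
      simp; linear_combination h + (n₀ ^ 2 + c₂ * n₁ ^ 2 + c₃ * n₂ ^ 2) * h2)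
    exact hxy ⟨by simpa using congrFun this 0, by simpa using congrFun this 1⟩
  wlog hn : n₃ = 1 generalizing x y n₀ n₁ n₂ n₃
  · refine this (x := x / n₃) (y := y / n₃) (n₀ := n₀ / n₃) (n₁ := n₁ / n₃) (n₂ := n₂ / n₃)
      (n₃ := 1) (by simpa [hn₃] using hxy) ?_ one_ne_zero rfl
    field_simp
    linear_combination h
  subst hn
  obtain ⟨x', y', hxy'⟩ : ∃ x' y', x * y' + x' * y = 1 := by
    by_cases hx : x = 0
    · exact ⟨y⁻¹, 0, by simp [mt (And.intro hx) hxy]⟩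
    · exact ⟨0, x⁻¹, by simp [hx]⟩
  have hc : c₂ * c₃ ≠ 0 := mul_ne_zero hc₂ hc₃
  let μ : (Fin 5 → F) → F := fun w => w 0 * y' + w 1 * x'
  let ν : (Fin 5 → F) → F := fun w => w 0 * y + w 1 * x
  let B : (Fin 5 → F) → Finset (Fin 2) → Fin 2 → F := fun w S =>
    if S = ∅ then ![w 2 + μ w * n₀, 0] else if S = {0} then ![w 3 + μ w * n₁, 0] else
      if S = {1} then ![w 4 + μ w * n₂, 0] else ![μ w, ν w / (c₂ * c₃)]
  have hB : IsLinearMap F B := by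
    constructor
    · intro v w
      ext S i
      simp only [B, μ, ν, Pi.add_apply]
      split_ifs <;> fin_cases i <;> simp <;> ring
    · intro r v
      ext S i
      simp only [B, μ, ν, Pi.smul_apply, smul_eq_mul]
      split_ifs <;> fin_cases i <;> simp <;> ring
  let d := (a * x' ^ 2 + x' * y' + b * y' ^ 2) * (c₂ * c₃)
  have key : ∀ v, l⁻¹ * φ v = pfisterQF 2 ![c₂, c₃] d (B (g v)) := by
    intro v
    have e1 : B (g v) ∅ = ![g v 2 + μ (g v) * n₀, 0] := rfl
    have e2 : B (g v) {0} = ![g v 3 + μ (g v) * n₁, 0] := rfl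
    have e3 : B (g v) {1} = ![g v 4 + μ (g v) * n₂, 0] := rfl
    have e4 : B (g v) {0, 1} = ![μ (g v), ν (g v) / (c₂ * c₃)] := rfl
    rw [hg, inv_mul_cancel_left₀ hl, pfisterQF_two_apply, e1, e2, e3, e4]
    simp only [binQF_apply]
    simp
    obtain ⟨q, hq⟩ : ∃ q, q = ν (g v) / (c₂ * c₃) := ⟨_, rfl⟩
    rw [← hq]
    rw [eq_div_iff hc] at hq
    have hμ : μ (g v) = g v 0 * y' + g v 1 * x' := rfl
    have hν : ν (g v) = g v 0 * y + g v 1 * x := rfl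
    have hx : g v 0 = μ (g v) * x + ν (g v) * x' := by
      rw [hμ, hν]
      linear_combination -g v 0 * hxy' - g v 1 * x * x' * h2
    have hy : g v 1 = μ (g v) * y + ν (g v) * y' := by
      rw [hμ, hν]
      linear_combination -g v 1 * hxy' - g v 0 * y * y' * h2
    generalize μ (g v) = m at *
    rw [← hq] at hx hy
    rw [hx, hy]
    simp only [d]
    linear_combination m ^ 2 * h + m * (c₂ * c₃) * q * hxy' +
      (a * m * (c₂ * c₃) * q * x * x' + b * m * (c₂ * c₃) * q * y * y' - g v 2 * m * n₀ -
        c₂ * g v 3 * m * n₁ - c₃ * g v 4 * m * n₂) * h2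
  have hπ : ∀ v, (((Units.mk0 l hl)⁻¹ : Fˣ) : F) * φ v = pfisterQF 2 (fun i => ((![Units.mk0 c₂ hc₂,
      Units.mk0 c₃ hc₃] i : Fˣ) : F)) d (B (g v)) := by
    intro v
    have : (fun i => ((![Units.mk0 c₂ hc₂, Units.mk0 c₃ hc₃] i : Fˣ) : F)) = ![c₂, c₃] := by
      ext i
      fin_cases i <;> rfl
    rw [this, ← key, Units.val_inv_eq_inv_val, Units.val_mk0]
  refine ⟨2, ![Units.mk0 c₂ hc₂, Units.mk0 c₃ hc₃], d, by simp, (Units.mk0 l hl)⁻¹,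
    hB.mk'.comp g.toLinearMap, ?_, ?_⟩
  · rw [injective_iff_map_eq_zero]
    intro v hv
    by_contra hv0
    have := hπ v
    rw [show B (g v) = 0 from hv, map_zero] at this
    exact hv0 (hφ v (by simpa [hl] using this))
  · exact hπ

end PfisterNeighbour

section NormalForm

variable {F : Type} [Field F]

lemma binsQF_apply {r : ℕ} (a b : Fin r → F) (v : Fin r → Fin 2 → F) :
    binsQF a b v = ∑ i, (a i * v i 0 ^ 2 + v i 0 * v i 1 + b i * v i 1 ^ 2) := by
  simp [binsQF, QuadraticMap.pi_apply, binQF_apply]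

lemma diagQF_apply {s : ℕ} (c : Fin s → F) (v : Fin s → F) : diagQF c v = ∑ i, c i * v i ^ 2 := by
  simp [diagQF, QuadraticMap.weightedSumSquares_apply, pow_two]

/-- Coordinates on `[a,b] ⊥ ⟨c₁,c₂,c₃⟩`, with the second one scaled by `u`. -/
def scaledCoordEquiv (u : F) (hu : u ≠ 0) :
    ((Fin 1 → Fin 2 → F) × (Fin 3 → F)) ≃ₗ[F] (Fin 5 → F) where
  toFun w := ![w.1 0 0, w.1 0 1 / u, w.2 0, w.2 1, w.2 2]
  map_add' v w := by ext i; fin_cases i <;> simp [add_div]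
  map_smul' r w := by ext i; fin_cases i <;> simp [mul_div_assoc]
  invFun v := (fun _ => ![v 0, u * v 1], ![v 2, v 3, v 4])
  left_inv w := by
    ext i j
    · fin_cases i
      fin_cases j
      · rfl
      · simp [mul_div_cancel₀, hu]
    · fin_cases i <;> rfl
  right_inv v := by ext i; fin_cases i <;> simp [hu]

lemma HasTypeRS.exists_scaled_form {φ : QuadraticForm F (Fin 5 → F)} (hφa : φ.Anisotropic)
    (hφ : HasTypeRS φ 1 3) : ∃ (l a b c₂ c₃ : F) (g : (Fin 5 → F) ≃ₗ[F] (Fin 5 → F)), l ≠ 0 ∧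
      ∀ v, φ v = l * (a * g v 0 ^ 2 + g v 0 * g v 1 + b * g v 1 ^ 2 + g v 2 ^ 2 +
        c₂ * g v 3 ^ 2 + c₃ * g v 4 ^ 2) := by
  obtain ⟨a, b, c, ⟨e⟩⟩ := hφ
  have he : ∀ v, φ v = ∑ i, (a i * (e v).1 i 0 ^ 2 + (e v).1 i 0 * (e v).1 i 1 +
      b i * (e v).1 i 1 ^ 2) + ∑ i, c i * (e v).2 i ^ 2 := fun v => by
    rw [← e.map_app, QuadraticMap.prod_apply, binsQF_apply, diagQF_apply]
  have hc : c 0 ≠ 0 := fun hc => by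
    have h0 := hφa (e.symm (0, ![1, 0, 0])) (by
      rw [he]; simp [hc, Fin.sum_univ_three])
    have h1 : (0, ![1, 0, 0]) = (0 : (Fin 1 → Fin 2 → F) × (Fin 3 → F)) := by
      rw [← e.apply_symm_apply (0, ![1, 0, 0]), h0]
      exact e.toLinearEquiv.map_zero
    simpa using congrFun (congrArg Prod.snd h1) 0
  refine ⟨c 0, a 0 / c 0, b 0 * c 0, c 1 / c 0, c 2 / c 0,
    e.toLinearEquiv.trans (scaledCoordEquiv (c 0) hc), hc, fun v => ?_⟩
  rw [he]
  simp only [Finset.univ_unique, Finset.sum_singleton, Fin.sum_univ_three, scaledCoordEquiv]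
  simp
  field_simp
  ring

end NormalForm

section NotNeighbour

variable {F : Type} [Field F] [CharP F 2]

lemma infinite_of_anisotropic {c₂ c₃ : F}
    (hc : ∀ x y z, x ^ 2 + c₂ * y ^ 2 + c₃ * z ^ 2 = 0 → x = 0 ∧ y = 0 ∧ z = 0) : Infinite F := by
  by_contra hF
  have : Finite F := not_infinite_iff_finite.1 hF
  obtain ⟨r, hr⟩ := (Finite.injective_iff_surjective.1 (frobenius_inj F 2)) c₂
  have := (hc r 1 0 (by
    rw [frobenius_def] at hr
    linear_combination hr + c₂ * CharTwo.two_eq_zero (R := F))).2.1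
  exact one_ne_zero this

theorem quadricPoly_dvd_of_not_isPfisterNeighbour {φ : QuadraticForm F (Fin 5 → F)}
    (hφ : φ.Anisotropic) (hn : ¬ IsPfisterNeighbour φ)
    {l a b c₂ c₃ : F} (hl : l ≠ 0) (g : (Fin 5 → F) ≃ₗ[F] (Fin 5 → F))
    (hg : ∀ v, φ v = l * (a * g v 0 ^ 2 + g v 0 * g v 1 + b * g v 1 ^ 2 + g v 2 ^ 2 +
      c₂ * g v 3 ^ 2 + c₃ * g v 4 ^ 2)) :
    Infinite F ∧ ∀ {τ : Type} {a₁ b₁ a₂ b₂ a₃ b₃ : F}, a₁ ≠ 0 → a₂ ≠ 0 →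
      ∀ (h : MvPolynomial τ F)
      (p : Fin 5 → Polynomial (Polynomial (Polynomial (MvPolynomial (Fin 3 ⊕ τ) F)))),
      quadricPoly a₁ b₁ a₂ b₂ a₃ b₃ h ∣ iterC _ F a * p 0 ^ 2 + p 0 * p 1 + iterC _ F b * p 1 ^ 2 +
        p 2 ^ 2 + iterC _ F c₂ * p 3 ^ 2 + iterC _ F c₃ * p 4 ^ 2 →
      ∀ i, quadricPoly a₁ b₁ a₂ b₂ a₃ b₃ h ∣ p i := by
  have hc : ∀ x y z, x ^ 2 + c₂ * y ^ 2 + c₃ * z ^ 2 = 0 → x = 0 ∧ y = 0 ∧ z = 0 := by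
    intro x y z h
    have h0 := hφ (g.symm ![0, 0, x, y, z]) (by rw [hg]; simp [h])
    rw [g.symm.map_eq_zero_iff] at h0
    exact ⟨congrFun h0 2, congrFun h0 3, congrFun h0 4⟩
  have hF := infinite_of_anisotropic hc
  refine ⟨hF, fun ha₁ ha₂ h p hp => ?_⟩
  obtain ⟨E, _, _, ι, s, t, hs, ht, hst, hE⟩ := exists_sqrt_extension hc
  refine quadricPoly_dvd_of_ternaryAniso ι ha₁ ha₂ h hs ht hst
    (ternaryAniso_of_square_values (Q := fun n => ∃ n₀ n₁ n₂ n₃ : F,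
      n = n₀ ^ 2 + c₂ * n₁ ^ 2 + c₃ * n₂ ^ 2 + c₂ * c₃ * n₃ ^ 2) ?_ ?_) p hp
  · intro z
    obtain ⟨n₀, n₁, n₂, n₃, hz⟩ := hE z
    exact ⟨_, ⟨n₀, n₁, n₂, n₃, rfl⟩, hz⟩
  · rintro x y ⟨n₀, n₁, n₂, n₃, hxy⟩
    by_contra h0
    exact hn (isPfisterNeighbour_of_represents hφ hl g hg h0 hxy)

end NotNeighbour

section Coordinates

variable {F : Type} [Field F]

lemma sum_coeffMat_mul {n : ℕ} (ψ : QuadraticForm F (Fin n → F)) (v : Fin n → F) :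
    ∑ i, ∑ j, coeffMat F ψ i j * (v i * v j) = ψ v := by
  have hv : v = ∑ i, v i • Pi.basisFun F (Fin n) i := by
    ext j
    simp [Finset.sum_apply, Pi.single_apply]
  conv_rhs => rw [← ψ.toQuadraticMap_toBilin (Pi.basisFun F (Fin n)),
    LinearMap.BilinMap.toQuadraticMap_apply, hv]
  simp_rw [LinearMap.map_sum₂, map_sum, LinearMap.map_smul₂, map_smul, QuadraticMap.toBilin_apply]
  refine Finset.sum_congr rfl fun i _ => Finset.sum_congr rfl fun j _ => ?_
  simp [coeffMat]
  split_ifs <;> ring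

lemma eval_qfPoly {n : ℕ} (ψ : QuadraticForm F (Fin n → F)) (v : Fin n → F) :
    eval v (qfPoly F ψ) = ψ v := by
  simp [qfPoly, ← sum_coeffMat_mul]

lemma extendQF_apply {K : Type} [CommRing K] (f : F →+* K) {n : ℕ}
    (φ : QuadraticForm F (Fin n → F)) (x : Fin n → K) :
    extendQF F f φ x = ∑ i, ∑ j, f (coeffMat F φ i j) * (x i * x j) := by
  simp only [extendQF, Matrix.toQuadraticMap', Matrix.toQuadraticForm',
    LinearMap.BilinMap.toQuadraticMap_apply, Matrix.toLinearMap₂'_apply, Matrix.map_apply,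
    smul_eq_mul]
  refine Finset.sum_congr rfl fun i _ => Finset.sum_congr rfl fun j _ => ?_
  ring

/-- The generic image of a family of polynomials under a linear map with constant coefficients. -/
noncomputable def linearCombo {ι κ σ : Type*} [Fintype ι] [DecidableEq ι] (g : (ι → F) →ₗ[F]
    (κ → F))
    (p : ι → MvPolynomial σ F) (k : κ) : MvPolynomial σ F :=
  ∑ j, MvPolynomial.C (g (Pi.single j 1) k) * p j

lemma eval_linearCombo {ι κ σ : Type*} [Fintype ι] [DecidableEq ι] (g : (ι → F) →ₗ[F] (κ → F))
    (p : ι → MvPolynomial σ F) (k : κ) (v : σ → F) :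
    eval v (linearCombo g p k) = g (fun i => eval v (p i)) k := by
  rw [LinearMap.pi_apply_eq_sum_univ g, Finset.sum_apply]
  simp only [linearCombo, map_sum, map_mul, eval_C, Pi.smul_apply, smul_eq_mul]
  refine Finset.sum_congr rfl fun j _ => ?_
  rw [mul_comm]
  rw [show (Pi.single j 1 : ι → F) = fun i => if j = i then 1 else 0 by
    ext i; simp [Pi.single_apply, eq_comm]]

/-- Linear substitution of variables. -/
noncomputable def linearSubst {ι κ : Type*} [Fintype ι] [DecidableEq ι] (g : (ι → F) →ₗ[F]
    (κ → F)) :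
    MvPolynomial κ F →ₐ[F] MvPolynomial ι F :=
  aeval (linearCombo g X)

lemma eval_linearSubst {ι κ : Type*} [Fintype ι] [DecidableEq ι] (g : (ι → F) →ₗ[F] (κ → F))
    (f : MvPolynomial κ F) (v : ι → F) : eval v (linearSubst g f) = eval (g v) f := by
  induction f using MvPolynomial.induction_on with
  | C c => simp [linearSubst]
  | add p q hp hq => simp only [map_add, hp, hq]
  | mul_X p i hp => rw [map_mul, map_mul, map_mul, hp, linearSubst, aeval_X, eval_linearCombo]; simp

/-- Invertible linear substitution of variables. -/
noncomputable def linearSubstEquiv [Infinite F] {ι κ : Type*} [Fintype ι] [DecidableEq ι]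
    [Fintype κ]
    [DecidableEq κ] (g : (ι → F) ≃ₗ[F] (κ → F)) : MvPolynomial κ F ≃ₐ[F] MvPolynomial ι F :=
  AlgEquiv.ofAlgHom (linearSubst g.toLinearMap) (linearSubst g.symm.toLinearMap)
    (AlgHom.ext fun f => MvPolynomial.funext fun v => by simp [eval_linearSubst])
    (AlgHom.ext fun f => MvPolynomial.funext fun v => by simp [eval_linearSubst])

/-- Separating three variables. -/
noncomputable def iterEquiv (F κ : Type*) [Field F] : MvPolynomial (Option (Option
    (Option κ))) F ≃+*
    Polynomial (Polynomial (Polynomial (MvPolynomial κ F))) :=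
  (optionEquivLeft F _).toRingEquiv.trans <| Polynomial.mapEquiv <|
    (optionEquivLeft F _).toRingEquiv.trans <| Polynomial.mapEquiv <|
      (optionEquivLeft F _).toRingEquiv

lemma iterEquiv_C (κ : Type*) (c : F) : iterEquiv F κ (MvPolynomial.C c) = iterC κ F c := by
  simp [iterEquiv, iterC, Polynomial.mapEquiv]

lemma iterEquiv_X_none (κ : Type*) : iterEquiv F κ (X none) = Polynomial.X := by
  simp [iterEquiv, Polynomial.mapEquiv]

lemma iterEquiv_X_some_none (κ : Type*) :
    iterEquiv F κ (X (some none)) = Polynomial.C Polynomial.X := by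
  simp [iterEquiv, Polynomial.mapEquiv]

lemma iterEquiv_X_some_some_none (κ : Type*) :
    iterEquiv F κ (X (some (some none))) = Polynomial.C (Polynomial.C Polynomial.X) := by
  simp [iterEquiv, Polynomial.mapEquiv]

lemma iterEquiv_X_some_some_some {κ : Type*} (k : κ) :
    iterEquiv F κ (X (some (some (some k)))) = Polynomial.C (Polynomial.C (Polynomial.C (X k))) :=
      by
  simp [iterEquiv, Polynomial.mapEquiv]

/-- The quadric `[a₁,b₁] ⊥ [a₂,b₂] ⊥ [a₃,b₃] ⊥ h` as a polynomial in all its variables. -/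
noncomputable def quadricMvPoly {τ : Type*} (a₁ b₁ a₂ b₂ a₃ b₃ : F) (h : MvPolynomial τ F) :
    MvPolynomial (Option (Option (Option (Fin 3 ⊕ τ)))) F :=
  let x (i : Option (Option (Option (Fin 3 ⊕ τ)))) :
    MvPolynomial (Option (Option (Option (Fin 3 ⊕ τ)))) F := X i
  MvPolynomial.C a₁ * x none ^ 2 + x (some none) * x none + MvPolynomial.C b₁ * x (some none) ^ 2 +
    MvPolynomial.C a₂ * x (some (some none)) ^ 2 +
    x (some (some (some (.inl 0)))) * x (some (some none)) +
    MvPolynomial.C b₂ * x (some (some (some (.inl 0)))) ^ 2 +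
    MvPolynomial.C a₃ * x (some (some (some (.inl 1)))) ^ 2 +
    x (some (some (some (.inl 1)))) * x (some (some (some (.inl 2)))) +
    MvPolynomial.C b₃ * x (some (some (some (.inl 2)))) ^ 2 +
    rename (fun i => some (some (some (.inr i)))) h

lemma iterEquiv_quadricMvPoly {τ : Type*} (a₁ b₁ a₂ b₂ a₃ b₃ : F) (h : MvPolynomial τ F) :
    iterEquiv F (Fin 3 ⊕ τ) (quadricMvPoly a₁ b₁ a₂ b₂ a₃ b₃ h) =
      quadricPoly a₁ b₁ a₂ b₂ a₃ b₃ h := by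
  have hr : ∀ h : MvPolynomial τ F, iterEquiv F (Fin 3 ⊕ τ) (rename (fun i => some (some (some (.inr
      i)))) h) =
      Polynomial.C (Polynomial.C (Polynomial.C (rename .inr h))) := by
    intro h
    induction h using MvPolynomial.induction_on with
    | C c => simp [iterEquiv_C, iterC]
    | add p q hp hq => simp only [map_add, hp, hq]
    | mul_X p i hp => simp only [map_mul, hp, rename_X, iterEquiv_X_some_some_some]
  simp only [map_add, map_mul, map_pow, hr, iterEquiv_C, iterEquiv_X_none, iterEquiv_X_some_none,
    iterEquiv_X_some_some_none, iterEquiv_X_some_some_some, quadricMvPoly, quadricPoly, quadYT,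
      residualPoly, residualConst, iterC,
    RingHom.comp_apply, add_assoc]

end Coordinates

section QuadricCoordinates

variable {F : Type} [Field F]

/-- Coordinates on `[a₁,b₁] ⊥ … ⊥ [a_{r+3},b_{r+3}] ⊥ ⟨c₁,…,c_s⟩` in which the first six
variables are separated from the remaining ones. -/
def quadricCoordEquiv (F : Type) [Field F] (r s : ℕ) :
    ((Fin (r + 3) → Fin 2 → F) × (Fin s → F)) ≃ₗ[F]
      (Option (Option (Option (Fin 3 ⊕ ((Fin r × Fin 2) ⊕ Fin s)))) → F) where
  toFun v
    | none => v.1 0 0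
    | some none => v.1 0 1
    | some (some none) => v.1 (Fin.succ 0) 0
    | some (some (some (.inl i))) =>
      ![v.1 (Fin.succ 0) 1, v.1 (Fin.succ (Fin.succ 0)) 0, v.1 (Fin.succ (Fin.succ 0)) 1] i
    | some (some (some (.inr (.inl i)))) => v.1 i.1.succ.succ.succ i.2
    | some (some (some (.inr (.inr i)))) => v.2 i
  map_add' v w := by
    ext k
    rcases k with _ | _ | _ | k | k | k
    iterate 3 rfl
    · fin_cases k <;> rfl
    iterate 2 rfl
  map_smul' c v := by
    ext k
    rcases k with _ | _ | _ | k | k | k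
    iterate 3 rfl
    · fin_cases k <;> rfl
    iterate 2 rfl
  invFun w :=
    (Fin.cons ![w none, w (some none)]
      (Fin.cons ![w (some (some none)), w (some (some (some (.inl 0))))]
        (Fin.cons ![w (some (some (some (.inl 1)))), w (some (some (some (.inl 2))))]
          fun i j => w (some (some (some (.inr (.inl (i, j)))))))),
      fun i => w (some (some (some (.inr (.inr i))))))
  left_inv v := by
    refine Prod.ext (funext fun i => ?_) rfl
    refine Fin.cases ?_ (fun i => Fin.cases ?_ (fun i => Fin.cases ?_ (fun i => rfl) i) i) i
    all_goals
      ext j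
      fin_cases j <;> rfl
  right_inv w := by
    ext k
    rcases k with _ | _ | _ | k | k | k
    iterate 3 rfl
    · fin_cases k <;> rfl
    iterate 2 rfl

lemma HasTypeRS.exists_quadric_coords {n r s : ℕ} {ψ : QuadraticForm F (Fin n → F)}
    (hψa : ψ.Anisotropic) (hψ : HasTypeRS ψ (r + 3) s) :
    ∃ (a₁ b₁ a₂ b₂ a₃ b₃ : F) (h : MvPolynomial ((Fin r × Fin 2) ⊕ Fin s) F)
      (g : (Fin n → F) ≃ₗ[F] (Option (Option (Option (Fin 3 ⊕ ((Fin r × Fin 2) ⊕ Fin s)))) → F)),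
      a₁ ≠ 0 ∧ a₂ ≠ 0 ∧ ∀ v, ψ v = eval (g v) (quadricMvPoly a₁ b₁ a₂ b₂ a₃ b₃ h) := by
  obtain ⟨a, b, c, ⟨e⟩⟩ := hψ
  have he : ∀ v, ψ v = ∑ i, (a i * (e v).1 i 0 ^ 2 + (e v).1 i 0 * (e v).1 i 1 +
      b i * (e v).1 i 1 ^ 2) + ∑ i, c i * (e v).2 i ^ 2 := fun v => by
    rw [← e.map_app, QuadraticMap.prod_apply, binsQF_apply, diagQF_apply]
  have ha : ∀ i, a i ≠ 0 := fun i hi => by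
    have h0 := hψa (e.symm (Pi.single i ![1, 0], 0)) (by
      rw [he, e.apply_symm_apply]
      rw [Finset.sum_eq_single i (fun j _ hj => by simp [hj]) (by simp)]
      simp [hi])
    have h1 : (Pi.single i ![1, 0], 0) = (0 : (Fin (r + 3) → Fin 2 → F) × (Fin s → F)) := by
      rw [← e.apply_symm_apply (Pi.single i ![1, 0], 0), h0]
      exact e.toLinearEquiv.map_zero
    simpa using congrFun (congrFun (congrArg Prod.fst h1) i) 0
  refine ⟨a 0, b 0, a (Fin.succ 0), b (Fin.succ 0), a (Fin.succ (Fin.succ 0)),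
    b (Fin.succ (Fin.succ 0)),
    ∑ i : Fin r, (MvPolynomial.C (a i.succ.succ.succ) * X (.inl (i, 0)) ^ 2 +
      X (.inl (i, 0)) * X (.inl (i, 1)) +
      MvPolynomial.C (b i.succ.succ.succ) * X (.inl (i, 1)) ^ 2) +
      ∑ i, MvPolynomial.C (c i) * X (.inr i) ^ 2,
    e.toLinearEquiv.trans (quadricCoordEquiv F r s), ha _, ha _, fun v => ?_⟩
  rw [he, Fin.sum_univ_succ, Fin.sum_univ_succ, Fin.sum_univ_succ]
  simp only [quadricMvPoly, map_add, map_mul, map_pow, map_sum, eval_C, eval_X, rename_C, rename_X]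
  simp only [quadricCoordEquiv, LinearEquiv.trans_apply, LinearEquiv.coe_mk, LinearMap.coe_mk,
    AddHom.coe_mk]
  simp
  ring

end QuadricCoordinates

section Transfer

variable {F : Type} [Field F]

lemma extendQF_anisotropic_of_dvd {m n : ℕ} {φ : QuadraticForm F (Fin m → F)}
    {ψ : QuadraticForm F (Fin n → F)}
    (h : ∀ p : Fin m → MvPolynomial (Fin n) F,
      qfPoly F ψ ∣ ∑ i, ∑ j, MvPolynomial.C (coeffMat F φ i j) * (p i * p j) →
        ∀ i, qfPoly F ψ ∣ p i) :
    (extendQF F (funFieldMap F ψ) φ).Anisotropic := by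
  intro x hx
  have : IsFractionRing (FunFieldRing F ψ) (FunField F ψ) :=
    inferInstanceAs (IsFractionRing (FunFieldRing F ψ) (FractionRing (FunFieldRing F ψ)))
  have : IsScalarTower F (FunFieldRing F ψ) (FunField F ψ) :=
    inferInstanceAs (IsScalarTower F (FunFieldRing F ψ) (FractionRing (FunFieldRing F ψ)))
  obtain ⟨b, hb⟩ := IsLocalization.exist_integer_multiples_of_finite
    (nonZeroDivisors (FunFieldRing F ψ)) x
  choose y hy using hb
  let q : MvPolynomial (Fin n) F →+* FunFieldRing F ψ := Ideal.Quotient.mk _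
  have hq : Function.Surjective q := Ideal.Quotient.mk_surjective
  have hq0 : ∀ f, q f = 0 ↔ qfPoly F ψ ∣ f := fun f =>
    Ideal.Quotient.eq_zero_iff_mem.trans Ideal.mem_span_singleton
  choose p hp using fun i => hq (y i)
  have hinj := IsFractionRing.injective (FunFieldRing F ψ) (FunField F ψ)
  have hC : ∀ c, funFieldMap F ψ c = algebraMap (FunFieldRing F ψ) (FunField F ψ)
      (q (MvPolynomial.C c)) := fun c =>
    IsScalarTower.algebraMap_apply F (FunFieldRing F ψ) (FunField F ψ) c
  have hpd := h p ((hq0 _).1 (hinj (by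
    rw [extendQF_apply] at hx
    rw [map_zero]
    simp only [map_sum, map_mul, hp, hy, ← hC, Algebra.smul_def]
    calc _ = (algebraMap _ (FunField F ψ) (b : FunFieldRing F ψ)) ^ 2 * ∑ i, ∑ j,
        funFieldMap F ψ (coeffMat F φ i j) * (x i * x j) := by
          simp only [Finset.mul_sum]
          exact Finset.sum_congr rfl fun i _ => Finset.sum_congr rfl fun j _ => by ring
      _ = 0 := by rw [hx, mul_zero])))
  ext i
  have hyi : y i = 0 := by rw [← hp, (hq0 _).2 (hpd i)]
  have hbx := hy i
  rw [hyi, map_zero, Algebra.smul_def] at hbx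
  exact (IsLocalization.map_units (FunField F ψ) b).mul_right_eq_zero.1 hbx.symm

end Transfer

theorem stmt4 (F : Type) [Field F] [CharP F 2]
    (φ : QuadraticForm F (Fin 5 → F)) (hφa : φ.Anisotropic) (hφt : HasTypeRS φ 1 3)
    (hφpn : ¬ IsPfisterNeighbour φ)
    (r s : ℕ) (hr : 3 ≤ r) (ψ : QuadraticForm F (Fin (2 * r + s) → F))
    (hψa : ψ.Anisotropic) (hψt : HasTypeRS ψ r s) :
    (extendQF F (funFieldMap F ψ) φ).Anisotropic := by
  obtain ⟨l, a, b, c₂, c₃, g, hl, hg⟩ := hφt.exists_scaled_form hφa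
  obtain ⟨hF, key⟩ := quadricPoly_dvd_of_not_isPfisterNeighbour hφa hφpn hl g hg
  obtain ⟨r, rfl⟩ : ∃ k, r = k + 3 := ⟨r - 3, by lia⟩
  obtain ⟨a₁, b₁, a₂, b₂, a₃, b₃, h, L, ha₁, ha₂, hL⟩ := hψt.exists_quadric_coords hψa
  let Θ := (linearSubstEquiv L).symm.toRingEquiv.trans (iterEquiv F (Fin 3 ⊕ ((Fin r × Fin 2) ⊕ Fin
      s)))
  have hΘ : ∀ f, Θ f = iterEquiv F _ ((linearSubstEquiv L).symm f) := fun f => rfl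
  have hΘC : ∀ c, Θ (MvPolynomial.C c) = iterC _ F c := fun c => by
    have hc : (linearSubstEquiv L).symm (MvPolynomial.C c) = MvPolynomial.C c :=
      (linearSubstEquiv L).symm.commutes c
    rw [hΘ, hc, iterEquiv_C]
  have hΘψ : Θ (qfPoly F ψ) = quadricPoly a₁ b₁ a₂ b₂ a₃ b₃ h := by
    have hψ : qfPoly F ψ = linearSubstEquiv L (quadricMvPoly a₁ b₁ a₂ b₂ a₃ b₃ h) :=
      MvPolynomial.funext fun v => by
        rw [eval_qfPoly, hL]
        exact (eval_linearSubst _ _ _).symm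
    rw [hΘ, hψ, AlgEquiv.symm_apply_apply, iterEquiv_quadricMvPoly]
  have hdvd : ∀ f, qfPoly F ψ ∣ f ↔ quadricPoly a₁ b₁ a₂ b₂ a₃ b₃ h ∣ Θ f := fun f => by
    rw [← hΘψ, map_dvd_iff Θ]
  refine extendQF_anisotropic_of_dvd fun p hp => ?_
  let G := linearCombo g.toLinearMap p
  have hG : ∑ i, ∑ j, MvPolynomial.C (coeffMat F φ i j) * (p i * p j) = MvPolynomial.C l *
      (MvPolynomial.C a * G 0 ^ 2 + G 0 * G 1 + MvPolynomial.C b * G 1 ^ 2 + G 2 ^ 2 +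
        MvPolynomial.C c₂ * G 3 ^ 2 + MvPolynomial.C c₃ * G 4 ^ 2) := by
    refine MvPolynomial.funext fun v => ?_
    simp only [map_sum, map_mul, map_add, map_pow, eval_C, G, eval_linearCombo]
    rw [sum_coeffMat_mul φ fun i => eval v (p i), hg]
    rfl
  rw [hG, ((isUnit_iff_ne_zero.2 hl).map MvPolynomial.C).dvd_mul_left, hdvd] at hp
  simp only [map_add, map_mul, map_pow, hΘC] at hp
  have hGd : ∀ k, qfPoly F ψ ∣ G k := fun k => (hdvd _).2 (key ha₁ ha₂ h (fun k => Θ (G k)) hp k)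
  intro i
  have hpi : p i = linearCombo g.symm.toLinearMap G i := MvPolynomial.funext fun v => by
    simp only [eval_linearCombo, G]
    exact (congrFun (g.symm_apply_apply fun i => eval v (p i)) i).symm
  rw [hpi]
  exact Finset.dvd_sum fun j _ => (hGd j).mul_left _
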